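/- Comparison principle on bounded domains (Lemma 3.18): Let Ω ⊂ ℝⁿ be a bounded domain, Ω_T = Ω × (0,T), and P_T the parabolic boundary of Ω_T (the points of Ω̄ × {0} together with ∂Ω × [0,T)). Suppose H satisfies Conditions A–C, σ ≥ 0, χ : (0,T) → ℝ is bounded and continuous, f̂ : (0,T) → (0,∞) is bounded and continuous, m ∈ ℝ, and Z : [m,∞) → ℝ is continuous and non-increasing. Let u be upper semicontinuous on Ω_T ∪ P_T and v lower semicontinuous on Ω_T ∪ P_T, with min(inf u, inf v) > m. Assume u is a viscosity subsolution and v a viscosity supersolution of H(Dw, D²w + Z(w)Dw⊗Dw) + χ(t)|Dw|^σ − f̂(t)w_t = 0 in Ω_T. If sup_{P_T} v < ∞ and u ≤ v on P_T, then u ≤ v in Ω_T. -/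

import Mathlib

open Set MeasureTheory

noncomputable section

/-- The rank-one matrix `q ⊗ q`. -/
def outerProd {n : ℕ} (q : EuclideanSpace ℝ (Fin n)) : Matrix (Fin n) (Fin n) ℝ :=
  Matrix.of fun i j => q i * q j

/-- The Loewner partial order on real matrices: `X ≤ Y` iff `Y - X` is positive semidefinite. -/
def LoewnerLE {n : ℕ} (X Y : Matrix (Fin n) (Fin n) ℝ) : Prop := (Y - X).PosSemidef

/-- Conditions A (monotonicity), B (homogeneity) and C (growth at infinity) on `H`. -/
structure ConditionsABC (n : ℕ)
    (H : EuclideanSpace ℝ (Fin n) → Matrix (Fin n) (Fin n) ℝ → ℝ) (k₁ : ℝ) : Prop where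
  continuous : Continuous fun p : EuclideanSpace ℝ (Fin n) × Matrix (Fin n) (Fin n) ℝ => H p.1 p.2
  monotone : ∀ q X Y, X.IsSymm → Y.IsSymm → LoewnerLE X Y → H q X ≤ H q Y
  zero_eq : ∀ q, H q 0 = 0
  k₁_nonneg : 0 ≤ k₁
  hom_q : ∀ (θ : ℝ) (q : EuclideanSpace ℝ (Fin n)) (X), H (θ • q) X = |θ| ^ k₁ * H q X
  hom_X : ∀ (θ : ℝ), 0 < θ → ∀ q X, H q (θ • X) = θ * H q X
  max_neg : ∀ e : EuclideanSpace ℝ (Fin n), ‖e‖ = 1 → H e (-1) < 0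
  min_pos : ∀ e : EuclideanSpace ℝ (Fin n), ‖e‖ = 1 → 0 < H e 1

/-- `Λ^sup = sup_λ max_{|e|=1} H(e, λ e⊗e + I) < ∞`. -/
def LambdaSupFinite (n : ℕ)
    (H : EuclideanSpace ℝ (Fin n) → Matrix (Fin n) (Fin n) ℝ → ℝ) : Prop :=
  ∃ C : ℝ, ∀ (lam : ℝ) (e : EuclideanSpace ℝ (Fin n)), ‖e‖ = 1 →
    H e (lam • outerProd e + 1) ≤ C

/-- `Λ^inf = inf_λ min_{|e|=1} H(e, λ e⊗e - I) > -∞`. -/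
def LambdaInfFinite (n : ℕ)
    (H : EuclideanSpace ℝ (Fin n) → Matrix (Fin n) (Fin n) ℝ → ℝ) : Prop :=
  ∃ C : ℝ, ∀ (lam : ℝ) (e : EuclideanSpace ℝ (Fin n)), ‖e‖ = 1 →
    C ≤ H e (lam • outerProd e - 1)

/-- The spatial gradient of `ψ` at `x`, as a vector in `ℝⁿ`. -/
def spaceGrad {n : ℕ} (ψ : EuclideanSpace ℝ (Fin n) → ℝ) (x : EuclideanSpace ℝ (Fin n)) :
    EuclideanSpace ℝ (Fin n) :=
  (EuclideanSpace.equiv (Fin n) ℝ).symm fun i => fderiv ℝ ψ x (EuclideanSpace.single i 1)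

/-- The spatial Hessian matrix of `ψ` at `x`. -/
def spaceHess {n : ℕ} (ψ : EuclideanSpace ℝ (Fin n) → ℝ) (x : EuclideanSpace ℝ (Fin n)) :
    Matrix (Fin n) (Fin n) ℝ :=
  Matrix.of fun i j =>
    fderiv ℝ (fun y => fderiv ℝ ψ y (EuclideanSpace.single j 1)) x (EuclideanSpace.single i 1)

/-- Viscosity subsolution of `F(t, u, Du, D²u, u_t) = 0` on `Ω ⊆ ℝⁿ × ℝ`, tested against
functions `φ(x,t)` that are C² in `x` and C¹ in `t`: whenever `u - φ` has a local maximum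
at `(x₀,t₀) ∈ Ω`, one has `F(t₀, u(x₀,t₀), Dφ, D²φ, φ_t) ≥ 0` there. -/
def ParabolicSubsolution {n : ℕ}
    (F : ℝ → ℝ → EuclideanSpace ℝ (Fin n) → Matrix (Fin n) (Fin n) ℝ → ℝ → ℝ)
    (Ω : Set (EuclideanSpace ℝ (Fin n) × ℝ)) (u : EuclideanSpace ℝ (Fin n) × ℝ → ℝ) : Prop :=
  ∀ φ : EuclideanSpace ℝ (Fin n) → ℝ → ℝ,
    (∀ t, ContDiff ℝ 2 fun x => φ x t) →
    (∀ x, ContDiff ℝ 1 fun t => φ x t) →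
    ∀ x₀ t₀, (x₀, t₀) ∈ Ω →
      IsLocalMaxOn (fun p => u p - φ p.1 p.2) Ω (x₀, t₀) →
      0 ≤ F t₀ (u (x₀, t₀)) (spaceGrad (fun x => φ x t₀) x₀) (spaceHess (fun x => φ x t₀) x₀)
          (deriv (φ x₀) t₀)

/-- Viscosity supersolution of `F(t, u, Du, D²u, u_t) = 0` on `Ω ⊆ ℝⁿ × ℝ`. -/
def ParabolicSupersolution {n : ℕ}
    (F : ℝ → ℝ → EuclideanSpace ℝ (Fin n) → Matrix (Fin n) (Fin n) ℝ → ℝ → ℝ)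
    (Ω : Set (EuclideanSpace ℝ (Fin n) × ℝ)) (u : EuclideanSpace ℝ (Fin n) × ℝ → ℝ) : Prop :=
  ∀ φ : EuclideanSpace ℝ (Fin n) → ℝ → ℝ,
    (∀ t, ContDiff ℝ 2 fun x => φ x t) →
    (∀ x, ContDiff ℝ 1 fun t => φ x t) →
    ∀ x₀ t₀, (x₀, t₀) ∈ Ω →
      IsLocalMinOn (fun p => u p - φ p.1 p.2) Ω (x₀, t₀) →
      F t₀ (u (x₀, t₀)) (spaceGrad (fun x => φ x t₀) x₀) (spaceHess (fun x => φ x t₀) x₀)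
          (deriv (φ x₀) t₀) ≤ 0


theorem cp_closing {E : Type*} [NormedAddCommGroup E] [InnerProductSpace ℝ E] [FiniteDimensional ℝ E]
    (K : Set E) (hK : K.Nonempty) (u : E → ℝ) (M : ℝ) (hM : ∀ x ∈ K, u x ≤ M) :
    ∃ (W : E → ℝ) (q : E → E),
      (∀ x ∈ K, ∀ z, u x - ‖x - z‖ ^ 2 / 2 ≤ W z) ∧
      (∀ z h, |W (z + h) - W z - inner ℝ (q z) h| ≤ ‖h‖ ^ 2 / 2) ∧
      (∀ (z : E) (c0 : ℝ) (q0 : E),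
        (∀ x ∈ K, ∀ z' : E, u x - ‖x - z'‖ ^ 2 / 2 ≤
          c0 + inner ℝ q0 (z' - z) + ‖z' - z‖ ^ 2 / 2) → W z ≤ c0) := by
  obtain ⟨x0, hx0⟩ := hK
  haveI : Nonempty K := ⟨⟨x0, hx0⟩⟩
  set A : E → ℝ := fun w => ⨆ x : K, (u x - ‖(x : E)‖ ^ 2 / 4 + inner ℝ (x : E) w) with hA
  have hbdd : ∀ w, BddAbove (range fun x : K => (u x - ‖(x : E)‖ ^ 2 / 4 + inner ℝ (x : E) w)) := by
    intro w
    refine ⟨M + ‖w‖ ^ 2, ?_⟩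
    rintro _ ⟨x, rfl⟩
    have h1 := hM x x.2
    have h2 := real_inner_le_norm (x : E) w
    simp only
    nlinarith [sq_nonneg (‖(x : E)‖ / 2 - ‖w‖)]
  have hA1 : ∀ x ∈ K, ∀ w, u x - ‖x‖ ^ 2 / 4 + inner ℝ x w ≤ A w := fun x hx w =>
    le_ciSup (hbdd w) ⟨x, hx⟩
  have hA2 : ∀ w c, (∀ x ∈ K, u x - ‖x‖ ^ 2 / 4 + inner ℝ x w ≤ c) → A w ≤ c := fun w c h =>
    ciSup_le fun x => h x x.2
  have hAconv : ∀ w1 w2 : E, ∀ a b : ℝ, 0 ≤ a → 0 ≤ b → a + b = 1 →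
      A (a • w1 + b • w2) ≤ a * A w1 + b * A w2 := by
    intro w1 w2 a b ha hb hab
    apply hA2
    intro x hx
    have h1 := mul_le_mul_of_nonneg_left (hA1 x hx w1) ha
    have h2 := mul_le_mul_of_nonneg_left (hA1 x hx w2) hb
    rw [inner_add_right, inner_smul_right, inner_smul_right]
    have : u x - ‖x‖ ^ 2 / 4 = a * (u x - ‖x‖ ^ 2 / 4) + b * (u x - ‖x‖ ^ 2 / 4) := by
      rw [← add_mul, hab, one_mul]
    linarith
  have hAcont : Continuous A := by
    have : ConvexOn ℝ univ A := ⟨convex_univ, fun w1 _ w2 _ a b ha hb hab => by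
      simpa using hAconv w1 w2 a b ha hb hab⟩
    exact continuousOn_univ.1 (this.continuousOn isOpen_univ)
  have hmin : ∀ z : E, ∃ w, ∀ y, A w + ‖w - z‖ ^ 2 ≤ A y + ‖y - z‖ ^ 2 := by
    intro z
    apply Continuous.exists_forall_le (f := fun w => A w + ‖w - z‖ ^ 2)
    · fun_prop
    · set c := u x0 - ‖x0‖ ^ 2 / 4 + inner ℝ x0 z with hc
      have h1 : Filter.Tendsto (fun r : ℝ => r * (r - ‖x0‖) + c) Filter.atTop Filter.atTop := by
        apply Filter.tendsto_atTop_add_const_right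
        apply Filter.Tendsto.atTop_mul_atTop₀ Filter.tendsto_id
        exact Filter.tendsto_atTop_add_const_right _ _ Filter.tendsto_id
      have h2 : Filter.Tendsto (fun w : E => ‖w - z‖) (Filter.cocompact E) Filter.atTop := by
        have h3 := tendsto_norm_cocompact_atTop (E := E)
        refine Filter.tendsto_atTop_mono (f := fun w : E => ‖w‖ + (-‖z‖)) ?_
          (Filter.tendsto_atTop_add_const_right _ _ h3)
        intro w
        have := norm_sub_norm_le w z
        linarith
      refine Filter.tendsto_atTop_mono ?_ (h1.comp h2)
      intro w
      simp only [Function.comp]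
      have h3 := hA1 x0 hx0 w
      have h4 : inner ℝ x0 w = inner ℝ x0 z + inner ℝ x0 (w - z) := by
        rw [← inner_add_right]; congr 1; abel
      have h5 := abs_real_inner_le_norm x0 (w - z)
      have h6 := neg_abs_le (inner ℝ x0 (w - z))
      nlinarith
  choose w hw using hmin
  set Wc : E → ℝ := fun z => A (w z) + ‖w z - z‖ ^ 2 with hWc
  have hWle : ∀ z y, Wc z ≤ A y + ‖y - z‖ ^ 2 := hw
  have hup : ∀ z h, Wc (z + h) ≤ Wc z + inner ℝ ((-2 : ℝ) • (w z - z)) h + ‖h‖ ^ 2 := by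
    intro z h
    have h1 := hWle (z + h) (w z)
    have h2 : ‖w z - (z + h)‖ ^ 2 = ‖w z - z‖ ^ 2 - 2 * inner ℝ (w z - z) h + ‖h‖ ^ 2 := by
      rw [← sub_sub, norm_sub_sq_real]
    rw [inner_smul_left]
    simp only [conj_trivial]
    have h3 : Wc z = A (w z) + ‖w z - z‖ ^ 2 := rfl
    linarith
  have hWconv : ∀ z1 z2 : E, ∀ a b : ℝ, 0 ≤ a → 0 ≤ b → a + b = 1 →
      Wc (a • z1 + b • z2) ≤ a * Wc z1 + b * Wc z2 := by
    intro z1 z2 a b ha hb hab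
    have h1 := hWle (a • z1 + b • z2) (a • w z1 + b • w z2)
    have h2 := hAconv (w z1) (w z2) a b ha hb hab
    have h3 : a • w z1 + b • w z2 - (a • z1 + b • z2) = a • (w z1 - z1) + b • (w z2 - z2) := by
      module
    have h4 : ‖a • (w z1 - z1) + b • (w z2 - z2)‖ ^ 2 ≤
        a * ‖w z1 - z1‖ ^ 2 + b * ‖w z2 - z2‖ ^ 2 := by
      have h5 : ‖a • (w z1 - z1) + b • (w z2 - z2)‖ ≤ a * ‖w z1 - z1‖ + b * ‖w z2 - z2‖ := by
        refine (norm_add_le _ _).trans ?_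
        rw [norm_smul, norm_smul, Real.norm_of_nonneg ha, Real.norm_of_nonneg hb]
      have h6 := pow_le_pow_left₀ (norm_nonneg _) h5 2
      refine h6.trans ?_
      have : b = 1 - a := by linarith
      subst this
      nlinarith [mul_nonneg (mul_nonneg ha hb) (sq_nonneg (‖w z1 - z1‖ - ‖w z2 - z2‖))]
    rw [h3] at h1
    simp only [hWc]
    simp only [hWc] at h1
    linarith
  have hdown : ∀ z h, Wc z + inner ℝ ((-2 : ℝ) • (w z - z)) h ≤ Wc (z + h) := by
    intro z h
    set g := (-2 : ℝ) • (w z - z)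
    have key : ∀ s : ℝ, 0 < s → Wc z + inner ℝ g h ≤ Wc (z + h) + s * ‖h‖ ^ 2 := by
      intro s hs
      have h1 := hWconv (z + h) (z + (-s) • h) (s / (1 + s)) (1 / (1 + s)) (by positivity)
        (by positivity) (by field_simp; ring)
      have h2 := hup z ((-s) • h)
      have h3 : (s / (1 + s)) • (z + h) + (1 / (1 + s)) • (z + (-s) • h) = z := by
        have e1 : (s / (1 + s)) + (1 / (1 + s)) = 1 := by field_simp; ring
        have e2 : (1 / (1 + s)) * (-s) = - (s / (1 + s)) := by ring
        rw [smul_add, smul_add, smul_smul, e2]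
        calc _ = ((s / (1 + s)) + (1 / (1 + s))) • z := by module
          _ = z := by rw [e1, one_smul]
      rw [h3] at h1
      rw [inner_smul_right, norm_smul, mul_pow, Real.norm_eq_abs, sq_abs] at h2
      have h4 : (1 + s) * Wc z ≤ s * Wc (z + h) + Wc (z + (-s) • h) := by
        have := mul_le_mul_of_nonneg_left h1 (by positivity : 0 ≤ 1 + s)
        have e : (1 + s) * (s / (1 + s) * Wc (z + h) + 1 / (1 + s) * Wc (z + -s • h)) =
            s * Wc (z + h) + Wc (z + (-s) • h) := by
          field_simp
        linarith
      have h5 : s * (Wc z + inner ℝ g h) ≤ s * (Wc (z + h) + s * ‖h‖ ^ 2) := by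
        nlinarith
      exact le_of_mul_le_mul_left h5 hs
    apply le_of_forall_pos_le_add
    intro ε hε
    have h1 := key (ε / (‖h‖ ^ 2 + 1)) (by positivity)
    have h2 : ε / (‖h‖ ^ 2 + 1) * ‖h‖ ^ 2 ≤ ε := by
      rw [div_mul_eq_mul_div, div_le_iff₀ (by positivity)]
      nlinarith [sq_nonneg ‖h‖]
    linarith
  refine ⟨fun z => Wc z - ‖z‖ ^ 2 / 2, fun z => z - (2 : ℝ) • w z, ?_, ?_, ?_⟩
  · intro x hx z
    have h1 := hA1 x hx (w z)
    have h2 : 0 ≤ ‖(1 / 2 : ℝ) • x + (w z - z)‖ ^ 2 := by positivity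
    simp only [hWc]
    rw [norm_add_sq_real, norm_smul, inner_smul_left, inner_sub_right] at h2
    rw [norm_sub_sq_real x z]
    simp only [conj_trivial, Real.norm_eq_abs, mul_pow, sq_abs] at h2
    linarith
  · intro z h
    have h1 := hup z h
    have h2 := hdown z h
    have h3 : inner ℝ (z - (2 : ℝ) • w z) h = inner ℝ ((-2 : ℝ) • (w z - z)) h - inner ℝ z h := by
      simp only [inner_sub_left, inner_smul_left, conj_trivial]
      ring
    have h4 := norm_add_sq_real z h
    simp only
    rw [abs_le, h3, h4]
    constructor <;> linarith
  · intro z c0 q0 hh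
    set y : E := (1 / 2 : ℝ) • (z - q0) with hy
    have hq : q0 = z - (2 : ℝ) • y := by rw [hy]; module
    have h1 := hWle z y
    have h2 : A y ≤ c0 - ‖y - z‖ ^ 2 + ‖z‖ ^ 2 / 2 := by
      apply hA2
      intro x hx
      have h3 := hh x hx ((1 / 2 : ℝ) • x + y)
      have h4 : x - ((1 / 2 : ℝ) • x + y) = (1 / 2 : ℝ) • x - y := by module
      rw [h4, hq] at h3
      simp only [← real_inner_self_eq_norm_sq, inner_sub_left, inner_sub_right, inner_add_left,
        inner_add_right, inner_smul_left, inner_smul_right, conj_trivial] at h3 ⊢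
      have e1 := real_inner_comm x y
      have e2 := real_inner_comm x z
      have e3 := real_inner_comm y z
      linarith
    simp only
    linarith

theorem cp_lip {E : Type*} [NormedAddCommGroup E] [InnerProductSpace ℝ E]
    (W : E → ℝ) (q : E → E)
    (h : ∀ z h, |W (z + h) - W z - inner ℝ (q z) h| ≤ ‖h‖ ^ 2 / 2) : LipschitzWith 3 q := by
  apply LipschitzWith.of_dist_le_mul
  intro z2 z1
  rw [dist_eq_norm, dist_eq_norm]
  set d := z2 - z1 with hd
  set g := q z2 - q z1 with hg
  by_cases hg0 : g = 0
  · rw [hg0]; simp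
  have hgn : 0 < ‖g‖ := norm_pos_iff.2 hg0
  set w : E := (‖d‖ / ‖g‖) • g with hw
  have hwn : ‖w‖ = ‖d‖ := by
    rw [hw, norm_smul, Real.norm_of_nonneg (by positivity)]; field_simp
  have a1 := abs_le.1 (h z1 (d + w))
  have a2 := abs_le.1 (h z2 w)
  have a3 := abs_le.1 (h z1 d)
  have e1 : z1 + (d + w) = z2 + w := by rw [hd]; abel
  have e2 : z1 + d = z2 := by rw [hd]; abel
  rw [e1, inner_add_right] at a1
  rw [e2] at a3
  have h4 : ‖d + w‖ ^ 2 ≤ (2 * ‖d‖) ^ 2 := by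
    apply pow_le_pow_left₀ (norm_nonneg _)
    have := norm_add_le d w
    linarith
  rw [hwn] at a2
  have h5 : inner ℝ g w ≤ 3 * ‖d‖ ^ 2 := by
    rw [hg, inner_sub_left]
    nlinarith [a1.1, a1.2, a2.1, a2.2, a3.1, a3.2]
  have h6 : inner ℝ g w = ‖d‖ * ‖g‖ := by
    rw [hw, inner_smul_right, real_inner_self_eq_norm_sq]; field_simp
  have h7 : ‖d‖ * ‖g‖ ≤ ‖d‖ * (3 * ‖d‖) := by nlinarith
  by_cases hd0 : d = 0
  · exfalso
    have : z2 = z1 := by rw [← sub_eq_zero]; exact hd0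
    apply hg0; rw [hg, this, sub_self]
  · have := le_of_mul_le_mul_left h7 (norm_pos_iff.2 hd0)
    simpa using this

theorem cp_taylor {E : Type*} [NormedAddCommGroup E] [InnerProductSpace ℝ E]
    (W : E → ℝ) (q : E → E)
    (h : ∀ z h, |W (z + h) - W z - inner ℝ (q z) h| ≤ ‖h‖ ^ 2 / 2) (z : E) (Q : E →L[ℝ] E)
    (hQ : HasFDerivAt q Q z) : ∀ ε > 0, ∃ δ > 0, ∀ k : E, ‖k‖ < δ →
      |W (z + k) - W z - inner ℝ (q z) k - inner ℝ (Q k) k / 2| ≤ ε * ‖k‖ ^ 2 := by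
  intro ε hε
  have h1 := hQ.isLittleO
  have h2 := (Asymptotics.isLittleO_iff.1 h1) hε
  obtain ⟨δ, hδ, h3⟩ := Metric.eventually_nhds_iff.1 h2
  refine ⟨δ, hδ, fun k hk => ?_⟩
  -- derivative along the segment
  have hder : ∀ s : ℝ, HasDerivAt (fun s : ℝ => W (z + s • k)) (inner ℝ (q (z + s • k)) k) s := by
    intro s
    rw [hasDerivAt_iff_isLittleO]
    have : (fun x' : ℝ => W (z + x' • k) - W (z + s • k) - (x' - s) • inner ℝ (q (z + s • k)) k)
        =O[nhds s] fun x' => (x' - s) ^ 2 := by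
      apply Asymptotics.IsBigO.of_bound (‖k‖ ^ 2 / 2)
      refine Filter.Eventually.of_forall fun x' => ?_
      have h4 := h (z + s • k) ((x' - s) • k)
      have e : z + s • k + (x' - s) • k = z + x' • k := by module
      rw [e, inner_smul_right, norm_smul, mul_pow] at h4
      simp only [Real.norm_eq_abs, smul_eq_mul, sq_abs, abs_pow] at h4 ⊢
      linarith
    refine this.trans_isLittleO ?_
    have h5 : (fun x : ℝ => x ^ 2) =o[nhds 0] fun x : ℝ => x := by
      simpa using (Asymptotics.isLittleO_pow_id (𝕜 := ℝ) (n := 2) (by norm_num))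
    have h6 : Filter.Tendsto (fun x' : ℝ => x' - s) (nhds s) (nhds 0) := by
      have : Continuous fun x' : ℝ => x' - s := by fun_prop
      simpa using this.tendsto s
    exact h5.comp_tendsto h6
  set G : ℝ → ℝ := fun s => W (z + s • k) - s * inner ℝ (q z) k - s ^ 2 * (inner ℝ (Q k) k / 2)
  have hG : ∀ s, HasDerivAt G (inner ℝ (q (z + s • k)) k - inner ℝ (q z) k
      - s * inner ℝ (Q k) k) s := by
    intro s
    have h7 := ((hder s).sub ((hasDerivAt_id s).mul_const (inner ℝ (q z) k))).sub
      ((hasDerivAt_pow 2 s).mul_const (inner ℝ (Q k) k / 2))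
    refine h7.congr_deriv ?_
    simp; ring
  have hb : ∀ s ∈ Icc (0 : ℝ) 1, ‖inner ℝ (q (z + s • k)) k - inner ℝ (q z) k
      - s * inner ℝ (Q k) k‖ ≤ ε * ‖k‖ ^ 2 := by
    intro s hs
    have h8 := h3 (y := z + s • k) (by
      rw [dist_eq_norm]; simp only [add_sub_cancel_left, norm_smul, Real.norm_of_nonneg hs.1]
      nlinarith [hs.2, norm_nonneg k])
    simp only [add_sub_cancel_left, map_smul] at h8
    have e : inner ℝ (q (z + s • k)) k - inner ℝ (q z) k - s * inner ℝ (Q k) k =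
        inner ℝ (q (z + s • k) - q z - s • Q k) k := by
      simp only [inner_sub_left, inner_smul_left, conj_trivial]
    rw [e]
    refine (norm_inner_le_norm _ _).trans ?_
    rw [norm_smul, Real.norm_of_nonneg hs.1] at h8
    have h9 : s * ‖k‖ ≤ ‖k‖ := by nlinarith [hs.2, norm_nonneg k]
    nlinarith [norm_nonneg k, norm_nonneg (q (z + s • k) - q z - s • Q k), 
      mul_le_mul_of_nonneg_left h9 hε.le]
  have h10 := Convex.norm_image_sub_le_of_norm_hasDerivWithin_le (f := G)
    (fun s _ => (hG s).hasDerivWithinAt) hb (convex_Icc 0 1)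
    (left_mem_Icc.2 zero_le_one) (right_mem_Icc.2 zero_le_one)
  simp only [G, Real.norm_eq_abs] at h10
  simp at h10
  have e3 : W (z + k) - W z - inner ℝ (q z) k - inner ℝ (Q k) k / 2 =
    W (z + k) - inner ℝ (q z) k - inner ℝ (Q k) k / 2 - W z := by ring
  rw [e3]; exact h10

theorem cp_rademacher {E : Type*} [NormedAddCommGroup E] [InnerProductSpace ℝ E]
    [FiniteDimensional ℝ E] (q q' : E → E) (hq : LipschitzWith 3 q) (hq' : LipschitzWith 3 q')
    (S : Set E) (ρ : ℝ) (hρ : 0 < ρ)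
    (hS : ∀ p : E, ‖p‖ < ρ → ∃ z ∈ S, q z - q' z = p) :
    ∃ z ∈ S, DifferentiableAt ℝ q z ∧ DifferentiableAt ℝ q' z := by
  by_contra hcon
  push Not at hcon
  letI : MeasurableSpace E := borel E
  haveI : BorelSpace E := ⟨rfl⟩
  set μ : Measure E := Measure.hausdorffMeasure (Module.finrank ℝ E) with hμ
  have h1 := hq.ae_differentiableAt (μ := μ)
  have h2 := hq'.ae_differentiableAt (μ := μ)
  have h3 : μ S = 0 := by
    refine measure_mono_null ?_ (h1.and h2)
    intro z hz hz'
    exact hcon z hz hz'.1 hz'.2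
  have h4 := (hq.sub hq').hausdorffMeasure_image_le (d := (Module.finrank ℝ E : ℝ)) (by positivity) S
  rw [← hμ, h3, mul_zero] at h4
  have h5 : Metric.ball (0 : E) ρ ⊆ (fun z => q z - q' z) '' S := by
    intro p hp
    obtain ⟨z, hz, e⟩ := hS p (by simpa using hp)
    exact ⟨z, hz, e⟩
  have h6 : μ (Metric.ball (0 : E) ρ) = 0 := measure_mono_null h5 (le_antisymm h4 bot_le)
  have h7 := Metric.measure_ball_pos μ (0 : E) hρ
  exact h7.ne' h6


theorem cp_neg_usc {X : Type*} [TopologicalSpace X] {v : X → ℝ} {K : Set X}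
    (h : LowerSemicontinuousOn v K) : UpperSemicontinuousOn (fun x => - v x) K := by
  intro x hx c hc
  have := h x hx (-c) (by simp only at hc; linarith)
  filter_upwards [this] with y hy
  linarith

theorem cp_quad_nonpos {E : Type*} [NormedAddCommGroup E] [InnerProductSpace ℝ E]
    (B : E →L[ℝ] E) (h : ∀ ε > 0, ∃ δ > 0, ∀ k : E, ‖k‖ < δ → inner ℝ (B k) k ≤ ε * ‖k‖ ^ 2) :
    ∀ k, inner ℝ (B k) k ≤ 0 := by
  intro k
  apply le_of_forall_pos_le_add
  intro ε hε
  obtain ⟨δ, hδ, h1⟩ := h (ε / (‖k‖ ^ 2 + 1)) (by positivity)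
  set s : ℝ := δ / (2 * (‖k‖ + 1)) with hs
  have hs0 : 0 < s := by positivity
  have h2 := h1 (s • k) (by
    rw [norm_smul, Real.norm_of_nonneg hs0.le, hs, div_mul_eq_mul_div, div_lt_iff₀ (by positivity)]
    nlinarith [norm_nonneg k])
  rw [map_smul, inner_smul_left, inner_smul_right, norm_smul, mul_pow, Real.norm_of_nonneg hs0.le] at h2
  simp only [conj_trivial] at h2
  have h3 : s ^ 2 * inner ℝ (B k) k ≤ s ^ 2 * (ε / (‖k‖ ^ 2 + 1) * ‖k‖ ^ 2) := by nlinarith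
  have h4 := le_of_mul_le_mul_left h3 (by positivity)
  have h5 : ε / (‖k‖ ^ 2 + 1) * ‖k‖ ^ 2 ≤ ε := by
    rw [div_mul_eq_mul_div, div_le_iff₀ (by positivity)]
    nlinarith [sq_nonneg ‖k‖]
  linarith

theorem cp_grad_eq {E : Type*} [NormedAddCommGroup E] [InnerProductSpace ℝ E]
    (a b : E) (h : ∀ k : E, inner ℝ a k ≤ inner ℝ b k + ‖k‖ ^ 2) : a = b := by
  have h1 := h ((1 / 2 : ℝ) • (a - b))
  rw [← sub_nonpos, ← sub_sub, ← inner_sub_left, inner_smul_right, real_inner_self_eq_norm_sq,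
    norm_smul, mul_pow] at h1
  have h2 : ‖(1 / 2 : ℝ)‖ ^ 2 = 1 / 4 := by norm_num
  rw [h2] at h1
  have h3 : ‖a - b‖ ^ 2 ≤ 0 := by linarith
  have h4 : ‖a - b‖ = 0 := by
    have := le_antisymm h3 (by positivity)
    exact pow_eq_zero_iff (two_ne_zero) |>.1 this
  exact sub_eq_zero.1 (norm_eq_zero.1 h4)

theorem cp_exists_max {E : Type*} [NormedAddCommGroup E] [InnerProductSpace ℝ E]
    (K : Set E) (hKc : IsCompact K) (hK : K.Nonempty) (u v : E → ℝ)
    (hu : UpperSemicontinuousOn u K) (hv : LowerSemicontinuousOn v K) (p : E) :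
    ∃ x ∈ K, ∃ y ∈ K, ∃ z, x + y - (2 : ℝ) • z = p ∧ ∀ x' ∈ K, ∀ y' ∈ K, ∀ z',
      u x' - v y' - ‖x' - z'‖ ^ 2 / 2 - ‖y' - z'‖ ^ 2 / 2 - inner ℝ p z' ≤
      u x - v y - ‖x - z‖ ^ 2 / 2 - ‖y - z‖ ^ 2 / 2 - inner ℝ p z := by
  set zz : E × E → E := fun w => (1 / 2 : ℝ) • (w.1 + w.2 - p) with hzz
  have hc : Continuous fun w : E × E => - (‖w.1 - zz w‖ ^ 2 / 2) - ‖w.2 - zz w‖ ^ 2 / 2 -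
      inner ℝ p (zz w) := by
    simp only [hzz]; fun_prop
  have h1 : UpperSemicontinuousOn (fun w : E × E => u w.1) (K ×ˢ K) :=
    hu.comp continuous_fst.continuousOn (fun w hw => hw.1)
  have h2 : UpperSemicontinuousOn (fun w : E × E => - v w.2) (K ×ˢ K) :=
    (cp_neg_usc hv).comp continuous_snd.continuousOn (fun w hw => hw.2)
  have h3 := (h1.add h2).add (hc.continuousOn (s := K ×ˢ K)).upperSemicontinuousOn
  obtain ⟨w, hw, hmax⟩ := h3.exists_isMaxOn (hK.prod hK) (hKc.prod hKc)
  refine ⟨w.1, hw.1, w.2, hw.2, zz w, ?_, ?_⟩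
  · simp only [hzz]; module
  intro x' hx' y' hy' z'
  have h4 := hmax (show (x', y') ∈ K ×ˢ K from ⟨hx', hy'⟩)
  simp only [mem_setOf_eq] at h4
  set z0 := zz (x', y') with hz0
  have h5 : ‖x' - z0‖ ^ 2 / 2 + ‖y' - z0‖ ^ 2 / 2 + inner ℝ p z0 ≤
      ‖x' - z'‖ ^ 2 / 2 + ‖y' - z'‖ ^ 2 / 2 + inner ℝ p z' := by
    have hp : p = x' + y' - (2 : ℝ) • z0 := by rw [hz0]; simp only [hzz]; module
    have h6 : 0 ≤ ‖z' - z0‖ ^ 2 := by positivity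
    rw [hp]
    simp only [← real_inner_self_eq_norm_sq, inner_sub_left, inner_sub_right, inner_add_left,
        inner_add_right, inner_smul_left, inner_smul_right, conj_trivial] at h6 ⊢
    have e1 := real_inner_comm x' z'
    have e2 := real_inner_comm y' z'
    have e3 := real_inner_comm x' z0
    have e4 := real_inner_comm y' z0
    have e5 := real_inner_comm z' z0
    linarith
  linarith

theorem cp_sums {E : Type*} [NormedAddCommGroup E] [InnerProductSpace ℝ E] [FiniteDimensional ℝ E]
    (K : Set E) (hKc : IsCompact K) (hK : K.Nonempty) (u v : E → ℝ)
    (hu : UpperSemicontinuousOn u K) (hv : LowerSemicontinuousOn v K) (ρ : ℝ) (hρ : 0 < ρ) :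
    ∃ (p x y z : E) (Q Q' : E →L[ℝ] E), ‖p‖ < ρ ∧ x ∈ K ∧ y ∈ K ∧ x + y - (2 : ℝ) • z = p ∧
      (∀ x' ∈ K, ∀ y' ∈ K, ∀ z',
        u x' - v y' - ‖x' - z'‖ ^ 2 / 2 - ‖y' - z'‖ ^ 2 / 2 - inner ℝ p z' ≤
        u x - v y - ‖x - z‖ ^ 2 / 2 - ‖y - z‖ ^ 2 / 2 - inner ℝ p z) ∧
      (∀ ε > 0, ∃ δ > 0, ∀ x' ∈ K, ‖x' - x‖ < δ → u x' ≤ u x + inner ℝ (x - z) (x' - x) +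
        inner ℝ (Q (x' - x)) (x' - x) / 2 + ε * ‖x' - x‖ ^ 2) ∧
      (∀ ε > 0, ∃ δ > 0, ∀ y' ∈ K, ‖y' - y‖ < δ → v y + inner ℝ (z - y) (y' - y) +
        inner ℝ (Q' (y' - y)) (y' - y) / 2 - ε * ‖y' - y‖ ^ 2 ≤ v y') ∧
      (∀ k, |inner ℝ (Q k) k| ≤ ‖k‖ ^ 2) ∧ (∀ k, |inner ℝ (Q' k) k| ≤ ‖k‖ ^ 2) ∧
      (∀ k, inner ℝ (Q k) k ≤ inner ℝ (Q' k) k) := by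
  obtain ⟨x1, -, hx1⟩ := hu.exists_isMaxOn hK hKc
  obtain ⟨y1, -, hy1⟩ := (cp_neg_usc hv).exists_isMaxOn hK hKc
  obtain ⟨W, q, hWa, hWb, hWc⟩ := cp_closing K hK u (u x1) (fun x hx => hx1 hx)
  obtain ⟨W2, q2, hVa, hVb, hVc⟩ := cp_closing K hK (fun y => - v y) (- v y1) (fun x hx => hy1 hx)
  have hq := cp_lip W q hWb
  have hq2 := cp_lip W2 q2 hVb
  set IsM : E → E → E → E → Prop := fun p x y z => ∀ x' ∈ K, ∀ y' ∈ K, ∀ z',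
      u x' - v y' - ‖x' - z'‖ ^ 2 / 2 - ‖y' - z'‖ ^ 2 / 2 - inner ℝ p z' ≤
      u x - v y - ‖x - z‖ ^ 2 / 2 - ‖y - z‖ ^ 2 / 2 - inner ℝ p z with hIsM
  -- consequences of maximality
  have hcons : ∀ p x y z, x ∈ K → y ∈ K → IsM p x y z →
      (W z = u x - ‖x - z‖ ^ 2 / 2) ∧ (W2 z = - v y - ‖y - z‖ ^ 2 / 2) ∧
      (∀ z', W z' + W2 z' - inner ℝ p z' ≤ W z + W2 z - inner ℝ p z) ∧ q z = x - z ∧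
      q2 z = y - z := by
    intro p x y z hx hy hm
    set m := u x - v y - ‖x - z‖ ^ 2 / 2 - ‖y - z‖ ^ 2 / 2 - inner ℝ p z with hmdef
    have hα : ∀ y0 ∈ K, ∀ z1, W z1 ≤ v y0 + ‖y0 - z1‖ ^ 2 / 2 + inner ℝ p z1 + m := by
      intro y0 hy0 z1
      apply hWc z1 _ (z1 - y0 + p)
      intro x' hx' z'
      have h1 := hm x' hx' y0 hy0 z'
      have h2 : v y0 + ‖y0 - z'‖ ^ 2 / 2 + inner ℝ p z' + m =
          v y0 + ‖y0 - z1‖ ^ 2 / 2 + inner ℝ p z1 + m + inner ℝ (z1 - y0 + p) (z' - z1) +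
            ‖z' - z1‖ ^ 2 / 2 := by
        simp only [← real_inner_self_eq_norm_sq, inner_sub_left, inner_sub_right, inner_add_left,
          inner_add_right]
        have e1 := real_inner_comm y0 z'
        have e2 := real_inner_comm y0 z1
        have e3 := real_inner_comm z1 z'
        linarith
      linarith
    have hβ : ∀ z1, W2 z1 ≤ - W z1 + inner ℝ p z1 + m := by
      intro z1
      apply hVc z1 _ (p - q z1)
      intro y0 hy0 z'
      have h1 := hα y0 hy0 z'
      have h2 := (abs_le.1 (hWb z1 (z' - z1))).1
      rw [add_sub_cancel] at h2
      rw [inner_sub_left, inner_sub_right p]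
      linarith
    have h1 := hWa x hx z
    have h2 := hVa y hy z
    have h3 := hβ z
    have hW : W z = u x - ‖x - z‖ ^ 2 / 2 := by linarith
    have hW2 : W2 z = - v y - ‖y - z‖ ^ 2 / 2 := by linarith
    refine ⟨hW, hW2, ?_, ?_, ?_⟩
    · intro z'
      have := hβ z'
      linarith
    · symm
      apply cp_grad_eq
      intro k
      have h4 := (abs_le.1 (hWb z k)).2
      have h5 := hWa x hx (z + k)
      rw [← sub_sub, norm_sub_sq_real (x - z)] at h5
      linarith
    · symm
      apply cp_grad_eq
      intro k
      have h4 := (abs_le.1 (hVb z k)).2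
      have h5 := hVa y hy (z + k)
      rw [← sub_sub, norm_sub_sq_real (y - z)] at h5
      linarith
  set S : Set E := {z | ∃ p x y, ‖p‖ < ρ ∧ x ∈ K ∧ y ∈ K ∧ x + y - (2 : ℝ) • z = p ∧ IsM p x y z}
    with hS
  have hq2' : LipschitzWith 3 (fun z => - q2 z) := hq2.neg
  obtain ⟨z, ⟨p, x, y, hp, hx, hy, hz, hm⟩, hd1, hd2⟩ := cp_rademacher q (fun z => - q2 z) hq hq2' S ρ hρ (by
    intro p hp
    obtain ⟨x, hx, y, hy, z, hz, hm⟩ := cp_exists_max K hKc hK u v hu hv p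
    obtain ⟨-, -, -, e1, e2⟩ := hcons p x y z hx hy hm
    refine ⟨z, ⟨p, x, y, hp, hx, hy, hz, hm⟩, ?_⟩
    rw [e1, e2, ← hz]; module)
  obtain ⟨hW, hW2, hmax, e1, e2⟩ := hcons p x y z hx hy hm
  have hd3 : DifferentiableAt ℝ q2 z := by simpa using hd2.neg
  set Q := fderiv ℝ q z with hQ
  set Q2 := fderiv ℝ q2 z with hQ2
  have ht := cp_taylor W q hWb z Q hd1.hasFDerivAt
  have ht2 := cp_taylor W2 q2 hVb z Q2 hd3.hasFDerivAt
  have hbound : ∀ (W : E → ℝ) (q : E → E) (Q : E →L[ℝ] E),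
      (∀ z h, |W (z + h) - W z - inner ℝ (q z) h| ≤ ‖h‖ ^ 2 / 2) →
      (∀ ε > 0, ∃ δ > 0, ∀ k : E, ‖k‖ < δ →
        |W (z + k) - W z - inner ℝ (q z) k - inner ℝ (Q k) k / 2| ≤ ε * ‖k‖ ^ 2) →
      ∀ k, |inner ℝ (Q k) k| ≤ ‖k‖ ^ 2 := by
    intro W q Q hWb ht k
    have l1 := cp_quad_nonpos (Q - ContinuousLinearMap.id ℝ E) (by
      intro ε hε
      obtain ⟨δ, hδ, h⟩ := ht (ε / 2) (by positivity)
      refine ⟨δ, hδ, fun k hk => ?_⟩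
      have h1 := abs_le.1 (h k hk)
      have h2 := abs_le.1 (hWb z k)
      simp only [ContinuousLinearMap.sub_apply, ContinuousLinearMap.id_apply, inner_sub_left,
        real_inner_self_eq_norm_sq]
      linarith [h1.1, h2.2]) k
    have l2 := cp_quad_nonpos (- Q - ContinuousLinearMap.id ℝ E) (by
      intro ε hε
      obtain ⟨δ, hδ, h⟩ := ht (ε / 2) (by positivity)
      refine ⟨δ, hδ, fun k hk => ?_⟩
      have h1 := abs_le.1 (h k hk)
      have h2 := abs_le.1 (hWb z k)
      simp only [ContinuousLinearMap.sub_apply, ContinuousLinearMap.id_apply, inner_sub_left,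
        real_inner_self_eq_norm_sq, ContinuousLinearMap.neg_apply, inner_neg_left]
      linarith [h1.2, h2.1]) k
    simp only [ContinuousLinearMap.sub_apply, ContinuousLinearMap.id_apply, inner_sub_left,
        real_inner_self_eq_norm_sq, ContinuousLinearMap.neg_apply, inner_neg_left] at l1 l2
    rw [abs_le]; constructor <;> linarith
  refine ⟨p, x, y, z, Q, -Q2, hp, hx, hy, hz, hm, ?_, ?_, hbound W q Q hWb ht, ?_, ?_⟩
  · intro ε hε
    obtain ⟨δ, hδ, h⟩ := ht ε hε
    refine ⟨δ, hδ, fun x' hx' hk => ?_⟩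
    have h1 := (abs_le.1 (h (x' - x) hk)).2
    have h2 := hWa x' hx' (z + (x' - x))
    have h3 : x' - (z + (x' - x)) = x - z := by abel
    rw [h3] at h2
    rw [e1] at h1
    linarith
  · intro ε hε
    obtain ⟨δ, hδ, h⟩ := ht2 ε hε
    refine ⟨δ, hδ, fun x' hx' hk => ?_⟩
    have h1 := (abs_le.1 (h (x' - y) hk)).2
    have h2 := hVa x' hx' (z + (x' - y))
    have h3 : x' - (z + (x' - y)) = y - z := by abel
    rw [h3] at h2
    rw [e2] at h1
    have h4 : inner ℝ (z - y) (x' - y) = - inner ℝ (y - z) (x' - y) := by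
      rw [← inner_neg_left, neg_sub]
    simp only [ContinuousLinearMap.neg_apply, inner_neg_left]
    linarith
  · intro k
    have := hbound W2 q2 Q2 hVb ht2 k
    simpa using this
  · intro k
    have l1 := cp_quad_nonpos (Q + Q2) (by
      intro ε hε
      obtain ⟨δ, hδ, h⟩ := ht (ε / 4) (by positivity)
      obtain ⟨δ', hδ', h'⟩ := ht2 (ε / 4) (by positivity)
      refine ⟨min δ δ', lt_min hδ hδ', fun k hk => ?_⟩
      have h1 := (abs_le.1 (h k (hk.trans_le (min_le_left _ _)))).1
      have h2 := (abs_le.1 (h' k (hk.trans_le (min_le_right _ _)))).1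
      have h3 := hmax (z + k)
      rw [inner_add_right] at h3
      have h4 : inner ℝ (q z) k + inner ℝ (q2 z) k = inner ℝ p k := by
        rw [← inner_add_left, e1, e2, ← hz]; congr 1; module
      simp only [ContinuousLinearMap.add_apply, inner_add_left]
      linarith) k
    simp only [ContinuousLinearMap.add_apply, inner_add_left, ContinuousLinearMap.neg_apply,
      inner_neg_left] at l1 ⊢
    linarith


/-- Gradient vector of `x ↦ ⟨q, A x⟩`. -/
def cpGrad {n : ℕ} {E : Type*} [NormedAddCommGroup E] [InnerProductSpace ℝ E]
    (A : EuclideanSpace ℝ (Fin n) →L[ℝ] E) (q : E) : EuclideanSpace ℝ (Fin n) :=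
  (EuclideanSpace.equiv (Fin n) ℝ).symm fun i => inner ℝ q (A (EuclideanSpace.single i 1))

/-- Hessian matrix of `x ↦ ⟨B (A x), A x⟩ / 2`. -/
def cpHess {n : ℕ} {E : Type*} [NormedAddCommGroup E] [InnerProductSpace ℝ E]
    (A : EuclideanSpace ℝ (Fin n) →L[ℝ] E) (B : E →L[ℝ] E) : Matrix (Fin n) (Fin n) ℝ :=
  Matrix.of fun i j =>
    (inner ℝ (B (A (EuclideanSpace.single i 1))) (A (EuclideanSpace.single j 1)) +
      inner ℝ (B (A (EuclideanSpace.single j 1))) (A (EuclideanSpace.single i 1))) / 2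

theorem cp_fderiv {n : ℕ} {E : Type*} [NormedAddCommGroup E] [InnerProductSpace ℝ E]
    (A : EuclideanSpace ℝ (Fin n) →L[ℝ] E) (B : E →L[ℝ] E) (q : E) (c : ℝ)
    (x0 x e : EuclideanSpace ℝ (Fin n)) :
    fderiv ℝ (fun x => c + (inner ℝ q (A (x - x0)) + inner ℝ (B (A (x - x0))) (A (x - x0)) / 2)) x e
      = inner ℝ q (A e) + (inner ℝ (B (A e)) (A (x - x0)) + inner ℝ (B (A (x - x0))) (A e)) / 2 := by
  have h0 : HasFDerivAt (fun x => A (x - x0)) A x := by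
    have := A.hasFDerivAt.comp x ((hasFDerivAt_id x).sub_const x0)
    simpa [Function.comp_def] using this
  have h1 : HasFDerivAt (fun x => B (A (x - x0))) (B.comp A) x := by
    have := B.hasFDerivAt.comp x h0
    simpa [Function.comp_def] using this
  have h2 := ((hasFDerivAt_const q x).inner ℝ h0).add ((h1.inner ℝ h0).const_mul (1 / 2 : ℝ))
  have h3 := (h2.const_add c).fderiv
  have h4 : (fun x => c + (inner ℝ q (A (x - x0)) + inner ℝ (B (A (x - x0))) (A (x - x0)) / 2)) =
      (fun y => c + ((fun t => inner ℝ q (A (t - x0))) + fun t => (1 / 2 : ℝ) * inner ℝ (B (A (t - x0))) (A (t - x0))) y) := by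
    ext y; simp only [Pi.add_apply]; ring
  rw [h4]
  rw [h3]
  simp [fderivInnerCLM_apply]
  ring

theorem cp_spaceGrad {n : ℕ} {E : Type*} [NormedAddCommGroup E] [InnerProductSpace ℝ E]
    (A : EuclideanSpace ℝ (Fin n) →L[ℝ] E) (B : E →L[ℝ] E) (q : E) (c : ℝ)
    (x0 : EuclideanSpace ℝ (Fin n)) :
    spaceGrad (fun x => c + (inner ℝ q (A (x - x0)) + inner ℝ (B (A (x - x0))) (A (x - x0)) / 2)) x0
      = cpGrad A q := by
  unfold spaceGrad cpGrad
  congr 1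
  ext i
  rw [cp_fderiv]
  simp

theorem cp_spaceHess {n : ℕ} {E : Type*} [NormedAddCommGroup E] [InnerProductSpace ℝ E]
    (A : EuclideanSpace ℝ (Fin n) →L[ℝ] E) (B : E →L[ℝ] E) (q : E) (c : ℝ)
    (x0 : EuclideanSpace ℝ (Fin n)) :
    spaceHess (fun x => c + (inner ℝ q (A (x - x0)) + inner ℝ (B (A (x - x0))) (A (x - x0)) / 2)) x0
      = cpHess A B := by
  unfold spaceHess cpHess
  ext i j
  simp only [Matrix.of_apply, cp_fderiv]
  set ei := A (EuclideanSpace.single i 1)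
  set ej := A (EuclideanSpace.single j 1) with hej
  have h0 : HasFDerivAt (fun x => A (x - x0)) A x0 := by
    have := A.hasFDerivAt.comp x0 ((hasFDerivAt_id x0).sub_const x0)
    simpa [Function.comp_def] using this
  have h1 : HasFDerivAt (fun x => B (A (x - x0))) (B.comp A) x0 := by
    have := B.hasFDerivAt.comp x0 h0
    simpa [Function.comp_def] using this
  have h2 := ((((hasFDerivAt_const (B ej) x0).inner ℝ h0).add
    (h1.inner ℝ (hasFDerivAt_const ej x0))).const_mul (1 / 2 : ℝ)).const_add (inner ℝ q ej)
  have h4 : (fun y => inner ℝ q ej + (inner ℝ (B ej) (A (y - x0)) + inner ℝ (B (A (y - x0))) ej) / 2) =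
      (fun x => inner ℝ q ej + 1 / 2 * ((fun t => inner ℝ (B ej) (A (t - x0))) + fun t => inner ℝ (B (A (t - x0))) ej) x) := by
    ext y; simp only [Pi.add_apply]; ring
  rw [h4, h2.fderiv]
  simp [fderivInnerCLM_apply]
  ring

/-- The test function. -/
def cpTest {n : ℕ} {E : Type*} [NormedAddCommGroup E] [InnerProductSpace ℝ E]
    (A : EuclideanSpace ℝ (Fin n) →L[ℝ] E) (τ : E) (B : E →L[ℝ] E) (q : E) (g : ℝ → ℝ)
    (x0 : EuclideanSpace ℝ (Fin n)) (t0 : ℝ) (x : EuclideanSpace ℝ (Fin n)) (t : ℝ) : ℝ :=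
  g t + (inner ℝ q (A (x - x0) + (t - t0) • τ) +
    inner ℝ (B (A (x - x0) + (t - t0) • τ)) (A (x - x0) + (t - t0) • τ) / 2)

theorem cpTest_props {n : ℕ} {E : Type*} [NormedAddCommGroup E] [InnerProductSpace ℝ E]
    (A : EuclideanSpace ℝ (Fin n) →L[ℝ] E) (τ : E) (B : E →L[ℝ] E) (q : E) (g : ℝ → ℝ)
    (hg : ContDiff ℝ 1 g) (x0 : EuclideanSpace ℝ (Fin n)) (t0 : ℝ) :
    (∀ t, ContDiff ℝ 2 fun x => cpTest A τ B q g x0 t0 x t) ∧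
    (∀ x, ContDiff ℝ 1 fun t => cpTest A τ B q g x0 t0 x t) ∧
    spaceGrad (fun x => cpTest A τ B q g x0 t0 x t0) x0 = cpGrad A q ∧
    spaceHess (fun x => cpTest A τ B q g x0 t0 x t0) x0 = cpHess A B ∧
    deriv (cpTest A τ B q g x0 t0 x0) t0 = deriv g t0 + inner ℝ q τ := by
  have hA := A.contDiff (n := 2)
  have hB : ∀ m, ContDiff ℝ m B := fun m => B.contDiff
  have e : (fun x => cpTest A τ B q g x0 t0 x t0) = fun x => g t0 + (inner ℝ q (A (x - x0)) +
      inner ℝ (B (A (x - x0))) (A (x - x0)) / 2) := by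
    ext x; simp [cpTest]
  refine ⟨?_, ?_, ?_, ?_, ?_⟩
  · intro t
    unfold cpTest
    have h1 : ContDiff ℝ 2 fun x : EuclideanSpace ℝ (Fin n) => A (x - x0) + (t - t0) • τ := by fun_prop
    have h2 := (hB 2).comp h1
    exact contDiff_const.add ((contDiff_const.inner ℝ h1).add ((h2.inner ℝ h1).div_const 2))
  · intro x
    unfold cpTest
    have h1 : ContDiff ℝ 1 fun t : ℝ => A (x - x0) + (t - t0) • τ := by fun_prop
    have h2 := (hB 1).comp h1
    exact hg.add ((contDiff_const.inner ℝ h1).add ((h2.inner ℝ h1).div_const 2))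
  · rw [e, cp_spaceGrad]
  · rw [e, cp_spaceHess]
  · have hgd : HasDerivAt g (deriv g t0) t0 :=
      ((hg.differentiable (by norm_num)) t0).hasDerivAt
    have h1 : HasDerivAt (fun t : ℝ => t - t0) 1 t0 := (hasDerivAt_id t0).sub_const t0
    have h2 := (hgd.add ((h1.mul_const (inner ℝ q τ)).add
      ((h1.pow 2).mul_const (inner ℝ (B τ) τ / 2))))
    have h3 := h2.deriv
    have e2 : cpTest A τ B q g x0 t0 x0 = (g + ((fun t : ℝ => (t - t0) * inner ℝ q τ) +
        fun t : ℝ => ((fun t : ℝ => t - t0) ^ 2) t * (inner ℝ (B τ) τ / 2))) := by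
      ext t
      simp only [cpTest, Pi.add_apply, Pi.pow_apply, sub_self, map_zero, zero_add, map_smul, inner_smul_left, inner_smul_right,
        conj_trivial]
      ring
    rw [e2, h3]
    simp

theorem cpHess_add {n : ℕ} {E : Type*} [NormedAddCommGroup E] [InnerProductSpace ℝ E]
    (A : EuclideanSpace ℝ (Fin n) →L[ℝ] E) (B C : E →L[ℝ] E) (ε : ℝ) :
    cpHess A (B + ε • C) = cpHess A B + ε • cpHess A C := by
  ext i j
  simp [cpHess, inner_add_left, inner_smul_left]
  ring

theorem cp_jet_sub {n : ℕ} {E : Type*} [NormedAddCommGroup E] [InnerProductSpace ℝ E]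
    (F : ℝ → ℝ → EuclideanSpace ℝ (Fin n) → Matrix (Fin n) (Fin n) ℝ → ℝ → ℝ)
    (hF : ∀ t r q pt, Continuous fun X => F t r q X pt)
    (O : Set (EuclideanSpace ℝ (Fin n) × ℝ)) (u : EuclideanSpace ℝ (Fin n) × ℝ → ℝ)
    (hu : ParabolicSubsolution F O u)
    (A : EuclideanSpace ℝ (Fin n) →L[ℝ] E) (τ : E) (Q : E →L[ℝ] E) (q : E) (g : ℝ → ℝ)
    (hg : ContDiff ℝ 1 g) (x0 : EuclideanSpace ℝ (Fin n)) (t0 : ℝ) (h0 : (x0, t0) ∈ O)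
    (hjet : ∀ ε > 0, ∀ᶠ w in nhdsWithin (x0, t0) O, u w - g w.2 ≤ u (x0, t0) - g t0 +
      inner ℝ q (A (w.1 - x0) + (w.2 - t0) • τ) +
      inner ℝ (Q (A (w.1 - x0) + (w.2 - t0) • τ)) (A (w.1 - x0) + (w.2 - t0) • τ) / 2 +
      ε * ‖A (w.1 - x0) + (w.2 - t0) • τ‖ ^ 2) :
    0 ≤ F t0 (u (x0, t0)) (cpGrad A q) (cpHess A Q) (deriv g t0 + inner ℝ q τ) := by
  have key : ∀ ε : ℝ, ε > 0 → 0 ≤ F t0 (u (x0, t0)) (cpGrad A q)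
      (cpHess A Q + ε • cpHess A (ContinuousLinearMap.id ℝ E)) (deriv g t0 + inner ℝ q τ) := by
    intro ε hε
    obtain ⟨p1, p2, p3, p4, p5⟩ := cpTest_props A τ (Q + ε • ContinuousLinearMap.id ℝ E) q g hg x0 t0
    have h1 := hu _ p1 p2 x0 t0 h0 (by
      filter_upwards [hjet (ε / 2) (by positivity)] with w hw
      simp only [cpTest, sub_self, map_zero, zero_smul, add_zero, inner_zero_right, zero_div]
      set k := A (w.1 - x0) + (w.2 - t0) • τ
      have : inner ℝ ((Q + ε • ContinuousLinearMap.id ℝ E) k) k = inner ℝ (Q k) k + ε * ‖k‖ ^ 2 := by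
        simp [inner_add_left, inner_smul_left]
      rw [this]
      linarith)
    rw [p3, p4, p5, cpHess_add] at h1
    exact h1
  have hc : Filter.Tendsto (fun ε : ℝ => F t0 (u (x0, t0)) (cpGrad A q)
      (cpHess A Q + ε • cpHess A (ContinuousLinearMap.id ℝ E)) (deriv g t0 + inner ℝ q τ))
      (nhdsWithin 0 (Ioi 0)) (nhds (F t0 (u (x0, t0)) (cpGrad A q) (cpHess A Q)
        (deriv g t0 + inner ℝ q τ))) := by
    have h2 : Continuous (fun ε : ℝ => F t0 (u (x0, t0)) (cpGrad A q)
      (cpHess A Q + ε • cpHess A (ContinuousLinearMap.id ℝ E)) (deriv g t0 + inner ℝ q τ)) :=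
      (hF t0 (u (x0, t0)) (cpGrad A q) (deriv g t0 + inner ℝ q τ)).comp (by fun_prop)
    have := h2.tendsto 0
    simp only [zero_smul, add_zero] at this
    exact this.mono_left nhdsWithin_le_nhds
  refine ge_of_tendsto hc ?_
  filter_upwards [self_mem_nhdsWithin] with ε hε using key ε hε

theorem cp_jet_super {n : ℕ} {E : Type*} [NormedAddCommGroup E] [InnerProductSpace ℝ E]
    (F : ℝ → ℝ → EuclideanSpace ℝ (Fin n) → Matrix (Fin n) (Fin n) ℝ → ℝ → ℝ)
    (hF : ∀ t r q pt, Continuous fun X => F t r q X pt)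
    (O : Set (EuclideanSpace ℝ (Fin n) × ℝ)) (u : EuclideanSpace ℝ (Fin n) × ℝ → ℝ)
    (hu : ParabolicSupersolution F O u)
    (A : EuclideanSpace ℝ (Fin n) →L[ℝ] E) (τ : E) (Q : E →L[ℝ] E) (q : E)
    (x0 : EuclideanSpace ℝ (Fin n)) (t0 : ℝ) (h0 : (x0, t0) ∈ O)
    (hjet : ∀ ε > 0, ∀ᶠ w in nhdsWithin (x0, t0) O, u (x0, t0) +
      inner ℝ q (A (w.1 - x0) + (w.2 - t0) • τ) +
      inner ℝ (Q (A (w.1 - x0) + (w.2 - t0) • τ)) (A (w.1 - x0) + (w.2 - t0) • τ) / 2 -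
      ε * ‖A (w.1 - x0) + (w.2 - t0) • τ‖ ^ 2 ≤ u w) :
    F t0 (u (x0, t0)) (cpGrad A q) (cpHess A Q) (inner ℝ q τ) ≤ 0 := by
  have key : ∀ ε : ℝ, ε > 0 → F t0 (u (x0, t0)) (cpGrad A q)
      (cpHess A Q + (-ε) • cpHess A (ContinuousLinearMap.id ℝ E)) (inner ℝ q τ) ≤ 0 := by
    intro ε hε
    obtain ⟨p1, p2, p3, p4, p5⟩ := cpTest_props A τ (Q + (-ε) • ContinuousLinearMap.id ℝ E) q
      (fun _ => (0 : ℝ)) contDiff_const x0 t0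
    have h1 := hu _ p1 p2 x0 t0 h0 (by
      filter_upwards [hjet (ε / 2) (by positivity)] with w hw
      simp only [cpTest, sub_self, map_zero, zero_smul, add_zero, inner_zero_right, zero_div]
      set k := A (w.1 - x0) + (w.2 - t0) • τ
      have : inner ℝ ((Q + (-ε) • ContinuousLinearMap.id ℝ E) k) k = inner ℝ (Q k) k - ε * ‖k‖ ^ 2 := by
        simp [inner_add_left, inner_smul_left, sub_eq_add_neg]
      rw [this]
      linarith)
    rw [p3, p4, p5, cpHess_add] at h1
    simpa using h1
  have hc : Filter.Tendsto (fun ε : ℝ => F t0 (u (x0, t0)) (cpGrad A q)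
      (cpHess A Q + (-ε) • cpHess A (ContinuousLinearMap.id ℝ E)) (inner ℝ q τ))
      (nhdsWithin 0 (Ioi 0)) (nhds (F t0 (u (x0, t0)) (cpGrad A q) (cpHess A Q)
        (inner ℝ q τ))) := by
    have h2 : Continuous (fun ε : ℝ => F t0 (u (x0, t0)) (cpGrad A q)
      (cpHess A Q + (-ε) • cpHess A (ContinuousLinearMap.id ℝ E)) (inner ℝ q τ)) :=
      (hF t0 (u (x0, t0)) (cpGrad A q) (inner ℝ q τ)).comp (by fun_prop)
    have := h2.tendsto 0
    simp only [neg_zero, zero_smul, add_zero] at this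
    exact this.mono_left nhdsWithin_le_nhds
  refine le_of_tendsto hc ?_
  filter_upwards [self_mem_nhdsWithin] with ε hε using key ε hε


theorem cp_scale (n : ℕ) (α β : ℝ) (hα : 0 < α) (hβ : 0 < β) :
    ∃ (A : EuclideanSpace ℝ (Fin n) →L[ℝ] WithLp 2 (EuclideanSpace ℝ (Fin n) × ℝ))
      (τ : WithLp 2 (EuclideanSpace ℝ (Fin n) × ℝ))
      (π : WithLp 2 (EuclideanSpace ℝ (Fin n) × ℝ) → EuclideanSpace ℝ (Fin n) × ℝ),
      Continuous π ∧ (∀ x t, π (A x + t • τ) = (x, t)) ∧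
      (∀ x (t : ℝ), ‖x‖ ≤ α * ‖A x + t • τ‖) ∧ (∀ x (t : ℝ), |t| ≤ β * ‖A x + t • τ‖) ∧
      (∀ x, ‖A x‖ = ‖x‖ / α) ∧ ‖τ‖ = 1 / β := by
  let A : EuclideanSpace ℝ (Fin n) →L[ℝ] WithLp 2 (EuclideanSpace ℝ (Fin n) × ℝ) :=
    (1 / α) • ((WithLp.prodContinuousLinearEquiv 2 ℝ (EuclideanSpace ℝ (Fin n)) ℝ).symm :
      (EuclideanSpace ℝ (Fin n) × ℝ) →L[ℝ] _).comp
      (ContinuousLinearMap.inl ℝ (EuclideanSpace ℝ (Fin n)) ℝ)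
  let τ : WithLp 2 (EuclideanSpace ℝ (Fin n) × ℝ) := WithLp.toLp 2 (0, 1 / β)
  have hf : ∀ x (t : ℝ), (A x + t • τ).fst = (1 / α) • x := by
    intro x t; simp [A, τ]
  have hs : ∀ x (t : ℝ), (A x + t • τ).snd = t / β := by
    intro x t; simp [A, τ, div_eq_mul_inv]
  have hnorm : ∀ x (t : ℝ), ‖A x + t • τ‖ ^ 2 = (‖x‖ / α) ^ 2 + (t / β) ^ 2 := by
    intro x t
    rw [WithLp.prod_norm_sq_eq_of_L2, hf, hs, norm_smul, Real.norm_of_nonneg (by positivity),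
      Real.norm_eq_abs, sq_abs]
    ring
  refine ⟨A, τ, fun ξ => (α • ξ.fst, β * ξ.snd), by fun_prop, ?_, ?_, ?_, ?_, ?_⟩
  · intro x t
    simp only [hf, hs]
    rw [smul_smul, mul_one_div_cancel hα.ne', one_smul, mul_div_cancel₀ _ hβ.ne']
  · intro x t
    have h := hnorm x t
    have : ‖x‖ / α ≤ ‖A x + t • τ‖ := by
      apply le_of_sq_le_sq _ (norm_nonneg _)
      rw [h]; nlinarith [sq_nonneg (t / β)]
    rwa [div_le_iff₀' hα] at this
  · intro x t
    have h := hnorm x t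
    have : |t| / β ≤ ‖A x + t • τ‖ := by
      apply le_of_sq_le_sq _ (norm_nonneg _)
      rw [h, div_pow, sq_abs, div_pow t]; nlinarith [sq_nonneg (‖x‖ / α)]
    rwa [div_le_iff₀' hβ] at this
  · intro x
    have h := hnorm x 0
    simp only [zero_smul, add_zero, zero_div] at h
    have h' : ‖A x‖ ^ 2 = (‖x‖ / α) ^ 2 := by rw [h]; ring
    exact (sq_eq_sq₀ (norm_nonneg _) (by positivity)).1 h'
  · have h := hnorm 0 1
    simp only [map_zero, zero_add, one_smul, norm_zero, zero_div] at h
    have h' : ‖τ‖ ^ 2 = (1 / β) ^ 2 := by rw [h]; ring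
    exact (sq_eq_sq₀ (norm_nonneg _) (by positivity)).1 h'

theorem cp_hess_bound {n : ℕ} {E : Type*} [NormedAddCommGroup E] [InnerProductSpace ℝ E]
    (A : EuclideanSpace ℝ (Fin n) →L[ℝ] E) (Q : E →L[ℝ] E) (α : ℝ)
    (hA : ∀ x, ‖A x‖ = ‖x‖ / α) (hQ : ∀ k, |inner ℝ (Q k) k| ≤ ‖k‖ ^ 2) (i j : Fin n) :
    |cpHess A Q i j| ≤ (1 / α) ^ 2 := by
  simp only [cpHess, Matrix.of_apply]
  have hi : ‖A (EuclideanSpace.single i (1:ℝ))‖ = 1 / α := by rw [hA]; simp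
  have hj : ‖A (EuclideanSpace.single j (1:ℝ))‖ = 1 / α := by rw [hA]; simp
  set k := A (EuclideanSpace.single i (1:ℝ))
  set l := A (EuclideanSpace.single j (1:ℝ))
  have h1 := hQ (k + l)
  have h2 := hQ (k - l)
  have h3 := parallelogram_law_with_norm ℝ k l
  simp only [map_add, map_sub, inner_add_left, inner_add_right, inner_sub_left,
    inner_sub_right] at h1 h2
  rw [hi, hj] at h3
  rw [abs_le] at *
  constructor <;> nlinarith

theorem cp_hess_symm {n : ℕ} {E : Type*} [NormedAddCommGroup E] [InnerProductSpace ℝ E]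
    (A : EuclideanSpace ℝ (Fin n) →L[ℝ] E) (Q : E →L[ℝ] E) : (cpHess A Q).IsSymm := by
  ext i j
  simp [cpHess, Matrix.transpose_apply, add_comm]

theorem cp_hess_quad {n : ℕ} {E : Type*} [NormedAddCommGroup E] [InnerProductSpace ℝ E]
    (A : EuclideanSpace ℝ (Fin n) →L[ℝ] E) (Q : E →L[ℝ] E) (x : Fin n → ℝ) :
    x ⬝ᵥ (cpHess A Q).mulVec x = inner ℝ (Q (A (WithLp.toLp 2 x))) (A (WithLp.toLp 2 x)) := by
  have hx : (WithLp.toLp 2 x : EuclideanSpace ℝ (Fin n)) =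
      ∑ i, x i • EuclideanSpace.single i (1:ℝ) := by
    ext k; simp [Finset.sum_apply, Pi.single_apply]
  rw [hx]
  simp only [map_sum, map_smul, sum_inner, inner_sum, inner_smul_left, inner_smul_right,
    conj_trivial, dotProduct, Matrix.mulVec, cpHess, Matrix.of_apply, Finset.mul_sum]
  have : ∀ f : Fin n → Fin n → ℝ, ∑ i, ∑ j, x i * ((f i j + f j i) / 2 * x j)
      = ∑ i, ∑ j, x i * (x j * f i j) := by
    intro f
    have h1 : ∑ i, ∑ j, x i * (x j * f j i) = ∑ i, ∑ j, x i * (x j * f i j) := by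
      rw [Finset.sum_comm]
      refine Finset.sum_congr rfl fun i _ => Finset.sum_congr rfl fun j _ => by ring
    have h2 : ∑ i, ∑ j, x i * ((f i j + f j i) / 2 * x j) =
        (∑ i, ∑ j, x i * (x j * f i j)) / 2 + (∑ i, ∑ j, x i * (x j * f j i)) / 2 := by
      rw [Finset.sum_div, Finset.sum_div, ← Finset.sum_add_distrib]
      refine Finset.sum_congr rfl fun i _ => ?_
      rw [Finset.sum_div, Finset.sum_div, ← Finset.sum_add_distrib]
      refine Finset.sum_congr rfl fun j _ => by ring
    rw [h2, h1]; ring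
  have h := this fun i j => inner ℝ (Q (A (EuclideanSpace.single i (1:ℝ))))
    (A (EuclideanSpace.single j (1:ℝ)))
  rw [h]
  rw [Finset.sum_comm]
  refine Finset.sum_congr rfl fun i _ => Finset.sum_congr rfl fun j _ => by ring

theorem cp_hess_le {n : ℕ} {E : Type*} [NormedAddCommGroup E] [InnerProductSpace ℝ E]
    (A : EuclideanSpace ℝ (Fin n) →L[ℝ] E) (Q Q' : E →L[ℝ] E)
    (h : ∀ k, inner ℝ (Q k) k ≤ inner ℝ (Q' k) k) : LoewnerLE (cpHess A Q) (cpHess A Q') := by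
  unfold LoewnerLE
  apply Matrix.PosSemidef.of_dotProduct_mulVec_nonneg
  · have := ((cp_hess_symm A Q').sub (cp_hess_symm A Q))
    rw [Matrix.IsHermitian, Matrix.conjTranspose_eq_transpose_of_trivial]
    exact this
  · intro x
    rw [star_trivial, Matrix.sub_mulVec, dotProduct_sub, cp_hess_quad, cp_hess_quad]
    linarith [h (A (WithLp.toLp 2 x))]


theorem cp_step {n : ℕ}
    (F : ℝ → ℝ → EuclideanSpace ℝ (Fin n) → Matrix (Fin n) (Fin n) ℝ → ℝ → ℝ)
    (hF : ∀ t r q pt, Continuous fun X => F t r q X pt)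
    (D O K0 : Set (EuclideanSpace ℝ (Fin n) × ℝ)) (hK0 : IsCompact K0) (hO : IsOpen O)
    (hOD : O ⊆ D) (hOK : O ⊆ K0)
    (u v : EuclideanSpace ℝ (Fin n) × ℝ → ℝ)
    (hsub : ParabolicSubsolution F D u) (hsuper : ParabolicSupersolution F D v)
    (hu : UpperSemicontinuousOn u K0) (hv : LowerSemicontinuousOn v K0)
    (g : ℝ → ℝ) (hg : ContDiff ℝ 1 g)
    (p0 : EuclideanSpace ℝ (Fin n) × ℝ) (hp0 : p0 ∈ K0)
    (B : ℝ) (hB : ∀ z ∈ K0, ∀ w ∈ K0, u z - g z.2 - v w ≤ B)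
    (α β ε C : ℝ) (hα : 0 < α) (hβ : 0 < β) (hε : 0 < ε) (hC : 0 ≤ C)
    (hBC : 2 * (B - (u p0 - g p0.2 - v p0) + ε) ≤ C ^ 2) :
    ∃ z ∈ K0, ∃ w ∈ K0, ∃ (q q' : EuclideanSpace ℝ (Fin n)) (a b : ℝ)
      (X Y : Matrix (Fin n) (Fin n) ℝ),
      (u p0 - g p0.2 - v p0) - ε ≤ u z - g z.2 - v w ∧
      ‖z.1 - w.1‖ ≤ α * (2 * C) ∧ |z.2 - w.2| ≤ β * (2 * C) ∧
      (∀ i, |q i| ≤ C / α) ∧ (∀ i, |q' i| ≤ C / α) ∧ (∀ i, |q i - q' i| ≤ ε) ∧ |a - b| ≤ ε ∧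
      X.IsSymm ∧ Y.IsSymm ∧ LoewnerLE X Y ∧ (∀ i j, |X i j| ≤ (1 / α) ^ 2) ∧
      (∀ i j, |Y i j| ≤ (1 / α) ^ 2) ∧
      (z ∈ O → 0 ≤ F z.2 (u z) q X (deriv g z.2 + a)) ∧
      (w ∈ O → F w.2 (v w) q' Y b ≤ 0) := by
  obtain ⟨A, τ, π, hπ, hπι, hx, ht, hA, hτ⟩ := cp_scale n α β hα hβ
  set ι : EuclideanSpace ℝ (Fin n) × ℝ → WithLp 2 (EuclideanSpace ℝ (Fin n) × ℝ) :=
    fun w => A w.1 + w.2 • τ with hι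
  have hιc : Continuous ι := by
    have := A.continuous
    simp only [hι]; fun_prop
  have hπι' : ∀ w, π (ι w) = w := fun w => hπι w.1 w.2
  have hιsub : ∀ w z, ι w - ι z = A (w.1 - z.1) + (w.2 - z.2) • τ := by
    intro w z; simp only [hι, map_sub, sub_smul]; abel
  set K := ι '' K0 with hK
  have hKc : IsCompact K := hK0.image hιc
  have hmaps : MapsTo π K K0 := by
    rintro _ ⟨w, hw, rfl⟩; rwa [hπι']
  obtain ⟨R, hR⟩ := hKc.isBounded.exists_norm_le
  have hR0 : 0 ≤ R := (norm_nonneg _).trans (hR (ι p0) (mem_image_of_mem _ hp0))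
  set ρ := min 1 (min (ε * β) (min (ε * α) (ε / (2 * R + 1)))) with hρ
  have hρ0 : 0 < ρ := by positivity
  have hρ1 : ρ ≤ 1 := min_le_left _ _
  have hρ2 : ρ ≤ ε * β := (min_le_right _ _).trans (min_le_left _ _)
  have hρ3 : ρ ≤ ε * α := (min_le_right _ _).trans ((min_le_right _ _).trans (min_le_left _ _))
  have hρ4 : ρ * (2 * R + 1) ≤ ε := by
    rw [← le_div_iff₀ (by positivity)]
    exact (min_le_right _ _).trans ((min_le_right _ _).trans (min_le_right _ _))
  have husc : UpperSemicontinuousOn (fun w => u w - g w.2) K0 := by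
    have h1 : UpperSemicontinuousOn (fun w : EuclideanSpace ℝ (Fin n) × ℝ => - g w.2) K0 := by
      apply Continuous.upperSemicontinuous _ |>.upperSemicontinuousOn
      have := hg.continuous
      fun_prop
    simpa [sub_eq_add_neg] using hu.add h1
  obtain ⟨p, x, y, z, Q, Q', hp, hxK, hyK, hxyz, hmax, hjx, hjy, hQ, hQ', hQQ⟩ :=
    cp_sums K hKc ⟨_, mem_image_of_mem _ hp0⟩ (fun ξ => u (π ξ) - g (π ξ).2) (fun ξ => v (π ξ))
      (husc.comp hπ.continuousOn hmaps) (hv.comp hπ.continuousOn hmaps) ρ hρ0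
  obtain ⟨zz, hzz, rfl⟩ := hxK
  obtain ⟨ww, hww, rfl⟩ := hyK
  simp only [hπι'] at hmax hjx hjy
  have hzn : ‖z‖ ≤ R + 1 / 2 := by
    have e : (2:ℝ) • z = ι zz + ι ww - p := by rw [← hxyz]; abel
    have h1 : ‖(2:ℝ) • z‖ ≤ R + R + 1 := by
      rw [e]
      refine (norm_sub_le _ _).trans (add_le_add ((norm_add_le _ _).trans (add_le_add ?_ ?_)) ?_)
      · exact hR _ (mem_image_of_mem _ hzz)
      · exact hR _ (mem_image_of_mem _ hww)
      · linarith
    rw [norm_smul, Real.norm_ofNat] at h1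
    linarith
  have hm0 := hmax (ι p0) (mem_image_of_mem _ hp0) (ι p0) (mem_image_of_mem _ hp0) (ι p0)
  simp only [hπι', sub_self, norm_zero] at hm0
  have hin : inner ℝ p (ι p0) - inner ℝ p z ≤ ε := by
    rw [← inner_sub_right]
    refine (real_inner_le_norm _ _).trans ?_
    have h1 : ‖ι p0 - z‖ ≤ 2 * R + 1 := by
      refine (norm_sub_le _ _).trans ?_
      linarith [hR _ (mem_image_of_mem _ hp0)]
    exact (mul_le_mul hp.le h1 (norm_nonneg _) hρ0.le).trans hρ4
  have hval : (u p0 - g p0.2 - v p0) - ε ≤ (u zz - g zz.2 - v ww) - ‖ι zz - z‖ ^ 2 / 2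
      - ‖ι ww - z‖ ^ 2 / 2 := by
    linarith
  have hBzw := hB zz hzz ww hww
  have hcx : ‖ι zz - z‖ ≤ C := by
    apply le_of_sq_le_sq _ hC
    nlinarith [sq_nonneg ‖ι ww - z‖]
  have hcy : ‖ι ww - z‖ ≤ C := by
    apply le_of_sq_le_sq _ hC
    nlinarith [sq_nonneg ‖ι zz - z‖]
  have hcy' : ‖z - ι ww‖ ≤ C := by rwa [norm_sub_rev]
  have hcxy : ‖ι zz - ι ww‖ ≤ 2 * C := by
    have e : ι zz - ι ww = (ι zz - z) + (z - ι ww) := by abel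
    rw [e]; refine (norm_add_le _ _).trans ?_; linarith
  have hsingle : ∀ i : Fin n, ‖A (EuclideanSpace.single i (1:ℝ))‖ = 1 / α := by
    intro i; rw [hA]; simp
  have hgr : ∀ (q : WithLp 2 (EuclideanSpace ℝ (Fin n) × ℝ)) (c : ℝ), ‖q‖ ≤ c → ∀ i,
      |cpGrad A q i| ≤ c / α := by
    intro q c hq i
    have : cpGrad A q i = inner ℝ q (A (EuclideanSpace.single i 1)) := by simp [cpGrad]
    rw [this]
    refine (abs_real_inner_le_norm _ _).trans ?_
    rw [hsingle, mul_one_div]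
    gcongr
  have hpe : (ι zz - z) - (z - ι ww) = p := by rw [← hxyz, two_smul]; abel
  refine ⟨zz, hzz, ww, hww, cpGrad A (ι zz - z), cpGrad A (z - ι ww), inner ℝ (ι zz - z) τ,
    inner ℝ (z - ι ww) τ, cpHess A Q, cpHess A Q', ?_, ?_, ?_, hgr _ _ hcx, hgr _ _ hcy', ?_, ?_,
    cp_hess_symm _ _, cp_hess_symm _ _, cp_hess_le _ _ _ hQQ, cp_hess_bound A Q α hA hQ,
    cp_hess_bound A Q' α hA hQ', ?_, ?_⟩
  · nlinarith [sq_nonneg ‖ι zz - z‖, sq_nonneg ‖ι ww - z‖]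
  · have h := hx (zz.1 - ww.1) (zz.2 - ww.2)
    rw [← hιsub] at h
    exact h.trans (by gcongr)
  · have h := ht (zz.1 - ww.1) (zz.2 - ww.2)
    rw [← hιsub] at h
    exact h.trans (by gcongr)
  · intro i
    have h1 : cpGrad A (ι zz - z) i - cpGrad A (z - ι ww) i = cpGrad A p i := by
      simp only [cpGrad, PiLp.continuousLinearEquiv_symm_apply, EuclideanSpace.equiv]
      rw [← inner_sub_left, hpe]
    rw [h1]
    refine (hgr p ρ hp.le i).trans ?_
    rwa [div_le_iff₀ hα]
  · rw [← inner_sub_left, hpe]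
    refine (abs_real_inner_le_norm _ _).trans ?_
    rw [hτ, mul_one_div, div_le_iff₀ hβ]
    linarith
  · intro hz
    refine cp_jet_sub F hF D u hsub A τ Q (ι zz - z) g hg zz.1 zz.2 (hOD hz) ?_
    intro ε' hε'
    obtain ⟨δ, hδ, hj⟩ := hjx ε' hε'
    apply Filter.Eventually.filter_mono nhdsWithin_le_nhds
    have e1 : ∀ᶠ w in nhds (zz.1, zz.2), w ∈ O := hO.mem_nhds hz
    have e2 : ∀ᶠ w in nhds (zz.1, zz.2), ‖ι w - ι zz‖ < δ := by
      have hc : Continuous fun w => ‖ι w - ι zz‖ := by fun_prop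
      apply hc.continuousAt.eventually_lt continuousAt_const
      simpa using hδ
    filter_upwards [e1, e2] with w h1 h2
    have := hj (ι w) (mem_image_of_mem _ (hOK h1)) h2
    rw [hπι', hιsub] at this
    exact this
  · intro hz
    refine cp_jet_super F hF D v hsuper A τ Q' (z - ι ww) ww.1 ww.2 (hOD hz) ?_
    intro ε' hε'
    obtain ⟨δ, hδ, hj⟩ := hjy ε' hε'
    apply Filter.Eventually.filter_mono nhdsWithin_le_nhds
    have e1 : ∀ᶠ w in nhds (ww.1, ww.2), w ∈ O := hO.mem_nhds hz
    have e2 : ∀ᶠ w in nhds (ww.1, ww.2), ‖ι w - ι ww‖ < δ := by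
      have hc : Continuous fun w => ‖ι w - ι ww‖ := by fun_prop
      apply hc.continuousAt.eventually_lt continuousAt_const
      simpa using hδ
    filter_upwards [e1, e2] with w h1 h2
    have := hj (ι w) (mem_image_of_mem _ (hOK h1)) h2
    rw [hπι', hιsub] at this
    exact this


theorem cp_ulim {α : Type*} [TopologicalSpace α] {S : Set α} (hS : IsCompact S) (f : ℕ → α)
    (hf : ∀ j, f j ∈ S) :
    ∃ x ∈ S, Filter.Tendsto f (Filter.hyperfilter ℕ : Filter ℕ) (nhds x) := by
  have h := hS.ultrafilter_le_nhds ((Filter.hyperfilter ℕ).map f) (by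
    rw [Filter.le_principal_iff]
    exact Filter.mem_map.2 (Filter.Eventually.of_forall hf))
  obtain ⟨x, hx, hle⟩ := h
  exact ⟨x, hx, hle⟩

theorem cp_usc_limit {α : Type*} [TopologicalSpace α] {K : Set α} (u v : α → ℝ)
    (hu : UpperSemicontinuousOn u K) (hv : LowerSemicontinuousOn v K) (θ : ℝ) (z w : ℕ → α)
    (hz : ∀ j, z j ∈ K) (hw : ∀ j, w j ∈ K) (z' w' : α) (hz' : z' ∈ K) (hw' : w' ∈ K)
    (l : Filter ℕ) [l.NeBot] (htz : Filter.Tendsto z l (nhds z'))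
    (htw : Filter.Tendsto w l (nhds w')) (h : ∀ j, θ ≤ u (z j) - v (w j)) :
    θ ≤ u z' - v w' := by
  by_contra hcon
  push Not at hcon
  set δ := (θ - (u z' - v w')) / 2 with hδ
  have hδ0 : 0 < δ := by rw [hδ]; linarith
  have h1 := hu z' hz' (u z' + δ) (by linarith)
  have h2 := hv w' hw' (v w' - δ) (by linarith)
  have htz' : Filter.Tendsto z l (nhdsWithin z' K) :=
    tendsto_nhdsWithin_iff.2 ⟨htz, Filter.Eventually.of_forall hz⟩
  have htw' : Filter.Tendsto w l (nhdsWithin w' K) :=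
    tendsto_nhdsWithin_iff.2 ⟨htw, Filter.Eventually.of_forall hw⟩
  obtain ⟨j, hj1, hj2⟩ := ((htz'.eventually h1).and (htw'.eventually h2)).exists
  have := h j
  linarith

theorem cp_interior {α : Type*} [PseudoMetricSpace α] {K O : Set α} (hK : IsCompact K)
    (hO : IsOpen O) (u v : α → ℝ)
    (hu : UpperSemicontinuousOn u K) (hv : LowerSemicontinuousOn v K) (θ : ℝ) (hθ : 0 < θ)
    (hout : ∀ w ∈ K, w ∉ O → u w ≤ v w) :
    ∃ r > 0, ∀ z ∈ K, ∀ w ∈ K, θ ≤ u z - v w → dist z w < r → z ∈ O ∧ w ∈ O := by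
  by_contra hcon
  push Not at hcon
  have hpos : ∀ j : ℕ, (0:ℝ) < 1 / ((j:ℝ) + 1) := fun j => by positivity
  choose z hz w hw h hd hn using fun j : ℕ => hcon (1 / ((j:ℝ) + 1)) (hpos j)
  obtain ⟨z', hz', htz⟩ := cp_ulim hK z hz
  have hd0 : Filter.Tendsto (fun j => dist (w j) (z j)) (Filter.hyperfilter ℕ : Filter ℕ)
      (nhds 0) := by
    refine squeeze_zero (fun _ => dist_nonneg) (fun j => ?_)
      ((tendsto_one_div_add_atTop_nhds_zero_nat (𝕜 := ℝ)).mono_left Nat.hyperfilter_le_atTop)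
    rw [dist_comm]; exact (hd j).le
  have htw : Filter.Tendsto w (Filter.hyperfilter ℕ : Filter ℕ) (nhds z') := by
    rw [tendsto_iff_dist_tendsto_zero] at htz ⊢
    have := hd0.add htz
    rw [add_zero] at this
    exact squeeze_zero (fun _ => dist_nonneg) (fun j => dist_triangle _ _ _) this
  have hlim := cp_usc_limit u v hu hv θ z w hz hw z' z' hz' hz' _ htz htw h
  have hzO : z' ∈ O := by
    by_contra hno
    have := hout z' hz' hno
    linarith
  obtain ⟨j, h1, h2⟩ := ((htz.eventually (hO.mem_nhds hzO)).and
    (htw.eventually (hO.mem_nhds hzO))).exists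
  exact hn j h1 h2

theorem cp_vec_lim {n : ℕ} (q : ℕ → EuclideanSpace ℝ (Fin n)) (C : ℝ)
    (h : ∀ j i, |q j i| ≤ C) :
    ∃ q', Filter.Tendsto q (Filter.hyperfilter ℕ : Filter ℕ) (nhds q') := by
  have : ∀ i, ∃ x ∈ Icc (-C) C, Filter.Tendsto (fun j => q j i)
      (Filter.hyperfilter ℕ : Filter ℕ) (nhds x) :=
    fun i => cp_ulim isCompact_Icc _ fun j => abs_le.1 (h j i)
  choose x _ hx using this
  refine ⟨WithLp.toLp 2 x, ?_⟩
  have h1 : Filter.Tendsto (fun j => (fun i => q j i)) (Filter.hyperfilter ℕ : Filter ℕ)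
      (nhds x) := tendsto_pi_nhds.2 hx
  exact ((PiLp.continuous_toLp 2 (fun _ : Fin n => ℝ)).tendsto x).comp h1

theorem cp_mat_lim {n : ℕ} (X : ℕ → Matrix (Fin n) (Fin n) ℝ) (C : ℝ)
    (h : ∀ j i k, |X j i k| ≤ C) :
    ∃ X', Filter.Tendsto X (Filter.hyperfilter ℕ : Filter ℕ) (nhds X') := by
  have : ∀ i k, ∃ x ∈ Icc (-C) C, Filter.Tendsto (fun j => X j i k)
      (Filter.hyperfilter ℕ : Filter ℕ) (nhds x) :=
    fun i k => cp_ulim isCompact_Icc _ fun j => abs_le.1 (h j i k)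
  choose x _ hx using this
  exact ⟨x, tendsto_pi_nhds.2 fun i => tendsto_pi_nhds.2 fun k => hx i k⟩

theorem cp_outer_continuous {n : ℕ} : Continuous (outerProd (n := n)) := by
  unfold outerProd
  refine continuous_matrix fun i j => ?_
  simp only [Matrix.of_apply]
  fun_prop

theorem cp_outer_symm {n : ℕ} (q : EuclideanSpace ℝ (Fin n)) : (outerProd q).IsSymm := by
  ext i j
  simp [outerProd, mul_comm]

theorem cp_outer_psd {n : ℕ} (q : EuclideanSpace ℝ (Fin n)) : (outerProd q).PosSemidef := by
  have : outerProd q = Matrix.vecMulVec (fun i => q i) (star fun i => q i) := by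
    ext i j; simp [outerProd, Matrix.vecMulVec_apply]
  rw [this]
  exact Matrix.posSemidef_vecMulVec_self_star _

theorem cp_limit (n : ℕ)
    (H : EuclideanSpace ℝ (Fin n) → Matrix (Fin n) (Fin n) ℝ → ℝ) (k₁ : ℝ)
    (hH : ConditionsABC n H k₁) (T : ℝ) (σ : ℝ) (hσ : 0 ≤ σ)
    (χ : ℝ → ℝ) (hχcont : ContinuousOn χ (Ioo 0 T))
    (fhat : ℝ → ℝ) (hfcont : ContinuousOn fhat (Ioo 0 T))
    (hfpos : ∀ t ∈ Ioo 0 T, 0 < fhat t)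
    (g' : ℝ → ℝ) (hg'c : Continuous g') (hg' : ∀ t, 0 < g' t)
    (t s : ℕ → ℝ) (ts : ℝ) (hts : ts ∈ Ioo 0 T)
    (htt : Filter.Tendsto t (Filter.hyperfilter ℕ : Filter ℕ) (nhds ts))
    (hss : Filter.Tendsto s (Filter.hyperfilter ℕ : Filter ℕ) (nhds ts))
    (q q' : ℕ → EuclideanSpace ℝ (Fin n)) (X Y : ℕ → Matrix (Fin n) (Fin n) ℝ)
    (ζ ζ' a b ε : ℕ → ℝ) (C C' Z0 Z1 : ℝ)
    (hε : Filter.Tendsto ε (Filter.hyperfilter ℕ : Filter ℕ) (nhds 0))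
    (hq : ∀ j i, |q j i| ≤ C) (hq' : ∀ j i, |q' j i| ≤ C)
    (hqq : ∀ j i, |q j i - q' j i| ≤ ε j) (hab : ∀ j, |a j - b j| ≤ ε j)
    (hX : ∀ j i k, |X j i k| ≤ C') (hY : ∀ j i k, |Y j i k| ≤ C')
    (hXs : ∀ j, (X j).IsSymm) (hYs : ∀ j, (Y j).IsSymm) (hXY : ∀ j, LoewnerLE (X j) (Y j))
    (hζ : ∀ j, ζ j ∈ Icc Z0 Z1) (hζ' : ∀ j, ζ' j ∈ Icc Z0 Z1) (hζζ : ∀ j, ζ j ≤ ζ' j)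
    (hs1 : ∀ᶠ j in (Filter.hyperfilter ℕ : Filter ℕ),
      0 ≤ H (q j) (X j + ζ j • outerProd (q j)) + χ (t j) * ‖q j‖ ^ σ
        - fhat (t j) * (g' (t j) + a j))
    (hs2 : ∀ᶠ j in (Filter.hyperfilter ℕ : Filter ℕ),
      H (q' j) (Y j + ζ' j • outerProd (q' j)) + χ (s j) * ‖q' j‖ ^ σ
        - fhat (s j) * b j ≤ 0) : False := by
  obtain ⟨qs, hqs⟩ := cp_vec_lim q C hq
  have hqs' : Filter.Tendsto q' (Filter.hyperfilter ℕ : Filter ℕ) (nhds qs) := by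
    obtain ⟨qs', h'⟩ := cp_vec_lim q' C hq'
    have : qs = qs' := by
      ext i
      have hp : Continuous fun p : EuclideanSpace ℝ (Fin n) => p i := by fun_prop
      have h1 := ((hp.tendsto _).comp hqs).sub ((hp.tendsto _).comp h')
      have h2 : Filter.Tendsto (fun j => q j i - q' j i) (Filter.hyperfilter ℕ : Filter ℕ)
          (nhds 0) := squeeze_zero_norm (fun j => hqq j i) hε
      have := tendsto_nhds_unique h1 h2
      linarith
    rwa [this]
  obtain ⟨Xs, hXlim⟩ := cp_mat_lim X C' hX
  obtain ⟨Ys, hYlim⟩ := cp_mat_lim Y C' hY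
  obtain ⟨z1, -, hz1⟩ := cp_ulim isCompact_Icc ζ hζ
  obtain ⟨z2, -, hz2⟩ := cp_ulim isCompact_Icc ζ' hζ'
  have hnhds : Ioo 0 T ∈ nhds ts := isOpen_Ioo.mem_nhds hts
  have hfat := hfcont.continuousAt hnhds
  have hχat := hχcont.continuousAt hnhds
  have hHlim : ∀ (p : ℕ → EuclideanSpace ℝ (Fin n)) (W : ℕ → Matrix (Fin n) (Fin n) ℝ)
      (c : ℕ → ℝ) Ws cs, Filter.Tendsto p (Filter.hyperfilter ℕ : Filter ℕ) (nhds qs) →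
      Filter.Tendsto W (Filter.hyperfilter ℕ : Filter ℕ) (nhds Ws) →
      Filter.Tendsto c (Filter.hyperfilter ℕ : Filter ℕ) (nhds cs) →
      Filter.Tendsto (fun j => H (p j) (W j + c j • outerProd (p j)))
        (Filter.hyperfilter ℕ : Filter ℕ) (nhds (H qs (Ws + cs • outerProd qs))) := by
    intro p W c Ws cs hp hW hc
    exact (hH.continuous.tendsto (qs, Ws + cs • outerProd qs)).comp
      (hp.prodMk_nhds (hW.add (hc.smul ((cp_outer_continuous.tendsto qs).comp hp))))
  have hle : H qs (Xs + z1 • outerProd qs) ≤ H qs (Ys + z2 • outerProd qs) := by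
    refine le_of_tendsto_of_tendsto' (hHlim q X ζ Xs z1 hqs hXlim hz1)
      (hHlim q Y ζ' Ys z2 hqs hYlim hz2) fun j => ?_
    refine hH.monotone _ _ _ ((hXs j).add ((cp_outer_symm _).smul _))
      ((hYs j).add ((cp_outer_symm _).smul _)) ?_
    have e : (Y j + ζ' j • outerProd (q j)) - (X j + ζ j • outerProd (q j)) =
        (Y j - X j) + (ζ' j - ζ j) • outerProd (q j) := by
      rw [sub_smul]; abel
    unfold LoewnerLE
    rw [e]
    exact (hXY j).add ((cp_outer_psd _).smul (sub_nonneg.2 (hζζ j)))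
  have hpow : ∀ (p : ℕ → EuclideanSpace ℝ (Fin n)),
      Filter.Tendsto p (Filter.hyperfilter ℕ : Filter ℕ) (nhds qs) →
      Filter.Tendsto (fun j => ‖p j‖ ^ σ) (Filter.hyperfilter ℕ : Filter ℕ) (nhds (‖qs‖ ^ σ)) := by
    intro p hp
    exact hp.norm.rpow_const (Or.inr hσ)
  have hfs : 0 < fhat ts := hfpos ts hts
  have L1 := (((hHlim q X ζ Xs z1 hqs hXlim hz1).add
    ((hχat.tendsto.comp htt).mul (hpow q hqs))).div (hfat.tendsto.comp htt) hfs.ne').sub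
    ((hg'c.tendsto ts).comp htt)
  have L2 := ((hHlim q' Y ζ' Ys z2 hqs' hYlim hz2).add
    ((hχat.tendsto.comp hss).mul (hpow q' hqs'))).div (hfat.tendsto.comp hss) hfs.ne'
  have L3 := L1.sub L2
  have hεn := hε.neg
  have hfin := le_of_tendsto_of_tendsto hεn L3 (by
    filter_upwards [hs1, hs2, htt.eventually hnhds, hss.eventually hnhds] with j h1 h2 h3 h4
    have f1 := hfpos _ h3
    have f2 := hfpos _ h4
    have h5 := neg_le_of_abs_le (hab j)
    have h6 : g' (t j) + a j ≤ (H (q j) (X j + ζ j • outerProd (q j)) + χ (t j) * ‖q j‖ ^ σ) /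
        fhat (t j) := by
      rw [le_div_iff₀ f1]; linarith
    have h7 : (H (q' j) (Y j + ζ' j • outerProd (q' j)) + χ (s j) * ‖q' j‖ ^ σ) /
        fhat (s j) ≤ b j := by
      rw [div_le_iff₀ f2]; linarith
    simp only [Function.comp_apply, Pi.div_apply, Pi.sub_apply, Pi.add_apply, Pi.mul_apply]
    linarith)
  have h8 : (H qs (Xs + z1 • outerProd qs) + χ ts * ‖qs‖ ^ σ) / fhat ts ≤
      (H qs (Ys + z2 • outerProd qs) + χ ts * ‖qs‖ ^ σ) / fhat ts := by
    gcongr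
  have := hg' ts
  linarith

/-- **Lemma 3.18** (comparison principle on bounded domains). `Ω_T = Ω × (0,T)` and the
parabolic boundary is `P_T = (Ω̄ × {0}) ∪ (∂Ω × [0,T))`. -/
theorem comparison_principle_bounded_domain
    (n : ℕ) (hn : 2 ≤ n)
    (H : EuclideanSpace ℝ (Fin n) → Matrix (Fin n) (Fin n) ℝ → ℝ) (k₁ : ℝ)
    (hH : ConditionsABC n H k₁)
    (T : ℝ) (hT : 0 < T)
    (Ω : Set (EuclideanSpace ℝ (Fin n)))
    (hΩopen : IsOpen Ω) (hΩbdd : Bornology.IsBounded Ω) (hΩconn : IsConnected Ω)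
    (σ : ℝ) (hσ : 0 ≤ σ)
    (χ : ℝ → ℝ) (hχcont : ContinuousOn χ (Ioo 0 T))
    (hχbdd : BddAbove ((fun t => |χ t|) '' Ioo 0 T))
    (fhat : ℝ → ℝ) (hfcont : ContinuousOn fhat (Ioo 0 T))
    (hfpos : ∀ t ∈ Ioo 0 T, 0 < fhat t) (hfbdd : BddAbove (fhat '' Ioo 0 T))
    (m : ℝ) (Z : ℝ → ℝ)
    (hZcont : ContinuousOn Z (Ici m)) (hZanti : AntitoneOn Z (Ici m))
    (u v : EuclideanSpace ℝ (Fin n) × ℝ → ℝ)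
    (husc : UpperSemicontinuousOn u
      ((Ω ×ˢ Ioo 0 T) ∪ ((closure Ω ×ˢ {(0:ℝ)}) ∪ (frontier Ω ×ˢ Ico 0 T))))
    (hlsc : LowerSemicontinuousOn v
      ((Ω ×ˢ Ioo 0 T) ∪ ((closure Ω ×ˢ {(0:ℝ)}) ∪ (frontier Ω ×ˢ Ico 0 T))))
    (hinf : ∃ c, m < c ∧ ∀ p ∈ (Ω ×ˢ Ioo 0 T) ∪ ((closure Ω ×ˢ {(0:ℝ)}) ∪ (frontier Ω ×ˢ Ico 0 T)),
      c ≤ u p ∧ c ≤ v p)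
    (hsub : ParabolicSubsolution
      (fun t r q X pt => H q (X + Z r • outerProd q) + χ t * ‖q‖ ^ σ - fhat t * pt)
      (Ω ×ˢ Ioo 0 T) u)
    (hsuper : ParabolicSupersolution
      (fun t r q X pt => H q (X + Z r • outerProd q) + χ t * ‖q‖ ^ σ - fhat t * pt)
      (Ω ×ˢ Ioo 0 T) v)
    (hvbdd : BddAbove (v '' ((closure Ω ×ˢ {(0:ℝ)}) ∪ (frontier Ω ×ˢ Ico 0 T))))
    (hbdry : ∀ p ∈ (closure Ω ×ˢ {(0:ℝ)}) ∪ (frontier Ω ×ˢ Ico 0 T), u p ≤ v p) :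
    ∀ p ∈ Ω ×ˢ Ioo 0 T, u p ≤ v p := by
  rintro ⟨x0, t0⟩ hp0
  by_contra hcon
  push Not at hcon
  obtain ⟨hx0, ht0⟩ := hp0
  simp only at hx0 ht0
  obtain ⟨c, hmc, hc⟩ := hinf
  set S := (Ω ×ˢ Ioo 0 T) ∪ ((closure Ω ×ˢ {(0:ℝ)}) ∪ (frontier Ω ×ˢ Ico 0 T)) with hS
  set T2 := (t0 + T) / 2 with hT2
  have ht0T2 : t0 < T2 := by rw [hT2]; linarith [ht0.2]
  have hT2T : T2 < T := by rw [hT2]; linarith [ht0.2]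
  set K0 : Set (EuclideanSpace ℝ (Fin n) × ℝ) := closure Ω ×ˢ Icc 0 T2 with hK0
  set O : Set (EuclideanSpace ℝ (Fin n) × ℝ) := Ω ×ˢ Ioo 0 T2 with hO
  have hK0c : IsCompact K0 := hΩbdd.isCompact_closure.prod isCompact_Icc
  have hOo : IsOpen O := hΩopen.prod isOpen_Ioo
  have hOD : O ⊆ Ω ×ˢ Ioo 0 T := fun w hw => ⟨hw.1, hw.2.1, hw.2.2.trans hT2T⟩
  have hOK : O ⊆ K0 := fun w hw => ⟨subset_closure hw.1, hw.2.1.le, hw.2.2.le⟩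
  have hfr : ∀ x, x ∈ closure Ω → x ∉ Ω → x ∈ frontier Ω := by
    intro x h1 h2
    rw [hΩopen.frontier_eq]
    exact ⟨h1, h2⟩
  have hKS : K0 ⊆ S := by
    rintro ⟨x, t⟩ ⟨h1, h2, h3⟩
    simp only at h1 h2 h3
    by_cases hx : x ∈ Ω
    · rcases h2.eq_or_lt with h | h
      · exact Or.inr (Or.inl ⟨h1, h.symm⟩)
      · exact Or.inl ⟨hx, h, h3.trans_lt hT2T⟩
    · exact Or.inr (Or.inr ⟨hfr x h1 hx, h2, h3.trans_lt hT2T⟩)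
  have huK : UpperSemicontinuousOn u K0 := husc.mono hKS
  have hvK : LowerSemicontinuousOn v K0 := hlsc.mono hKS
  have hp0O : (x0, t0) ∈ O := ⟨hx0, ht0.1, ht0T2⟩
  have hp0K : (x0, t0) ∈ K0 := hOK hp0O
  obtain ⟨pm, hpm, hmax⟩ := huK.exists_isMaxOn ⟨_, hp0K⟩ hK0c
  set M := u pm with hM
  have hMle : ∀ w ∈ K0, u w ≤ M := fun w hw => hmax hw
  have hcM : c ≤ M := (hc pm (hKS hpm)).1
  -- the barrier
  set η := (u (x0, t0) - v (x0, t0)) / 2 with hη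
  have hη0 : 0 < η := by rw [hη]; linarith
  set lam := ((M - c) / η + 1) / (T2 - t0) with hlam
  have hd0 : 0 < T2 - t0 := by linarith
  have hlam0 : 0 < lam := by
    have : 0 ≤ (M - c) / η := div_nonneg (by linarith) hη0.le
    positivity
  set g : ℝ → ℝ := fun t => η * Real.exp (lam * (t - t0)) with hg
  have hgc : ContDiff ℝ 1 g := by
    simp only [hg]; fun_prop
  have hgpos : ∀ t, 0 < g t := fun t => by simp only [hg]; positivity
  have hgd : deriv g = fun t => lam * g t := by
    funext t
    have h1 : HasDerivAt (fun t => lam * (t - t0)) lam t := by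
      simpa using ((hasDerivAt_id t).sub_const t0).const_mul lam
    have h2 := (h1.exp.const_mul η).deriv
    simp only [hg] at h2 ⊢
    rw [h2]; ring
  have hgT : M - c ≤ g T2 := by
    have h1 : lam * (T2 - t0) = (M - c) / η + 1 := by
      rw [hlam]; field_simp
    have h2 := Real.add_one_le_exp ((M - c) / η + 1)
    simp only [hg]
    rw [h1]
    have h3 : η * ((M - c) / η + 1 + 1) = M - c + 2 * η := by field_simp; ring
    have h4 := mul_le_mul_of_nonneg_left h2 hη0.le
    linarith
  have hg0 : g t0 = η := by simp [hg]
  set θ := u (x0, t0) - g t0 - v (x0, t0) with hθ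
  have hθη : θ = η := by rw [hθ, hg0, hη]; ring
  have hout : ∀ w ∈ K0, w ∉ O → u w - g w.2 ≤ v w := by
    rintro ⟨x, t⟩ hw hwO
    have hgt := hgpos t
    have hb : (x, t) ∈ (closure Ω ×ˢ {(0:ℝ)}) ∪ (frontier Ω ×ˢ Ico 0 T) →
        u (x, t) - g t ≤ v (x, t) := by
      intro h
      have := hbdry _ h
      linarith
    obtain ⟨h1, h2, h3⟩ := id hw
    simp only at h1 h2 h3
    by_cases hx : x ∈ Ω
    · rcases h2.eq_or_lt with h | h
      · exact hb (Or.inl ⟨h1, h.symm⟩)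
      · rcases h3.eq_or_lt with h' | h'
        · have e1 := hMle _ hw
          have e2 := (hc _ (hKS hw)).2
          subst h'
          simp only
          linarith
        · exact absurd ⟨hx, h, h'⟩ hwO
    · exact hb (Or.inr ⟨hfr x h1 hx, h2, h3.trans_lt hT2T⟩)
  have husc' : UpperSemicontinuousOn (fun w => u w - g w.2) K0 := by
    have h1 : UpperSemicontinuousOn (fun w : EuclideanSpace ℝ (Fin n) × ℝ => - g w.2) K0 := by
      apply Continuous.upperSemicontinuous _ |>.upperSemicontinuousOn
      have := hgc.continuous
      fun_prop
    simpa [sub_eq_add_neg] using huK.add h1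
  obtain ⟨r, hr, hrO⟩ := cp_interior hK0c hOo (fun w => u w - g w.2) v husc' hvK (η / 2)
    (by positivity) hout
  set C := |2 * ((M - c) - θ + η / 2)| + 1 with hC
  have hC1 : 1 ≤ C := by rw [hC]; linarith [abs_nonneg (2 * ((M - c) - θ + η / 2))]
  set α := r / (4 * C) with hα
  have hα0 : 0 < α := by positivity
  have hαC : α * (2 * C) = r / 2 := by rw [hα]; field_simp; norm_num
  have hj0 : ∀ j : ℕ, 0 < 1 / ((j:ℝ) + 1) := fun j => by positivity
  have hj1 : ∀ j : ℕ, 1 / ((j:ℝ) + 1) ≤ 1 := fun j => by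
    rw [div_le_one (by positivity)]
    linarith [(Nat.cast_nonneg j : (0:ℝ) ≤ j)]
  have hFc : ∀ (t r : ℝ) (q : EuclideanSpace ℝ (Fin n)) (pt : ℝ), Continuous fun X =>
      (fun t r q X pt => H q (X + Z r • outerProd q) + χ t * ‖q‖ ^ σ - fhat t * pt :
        ℝ → ℝ → EuclideanSpace ℝ (Fin n) → Matrix (Fin n) (Fin n) ℝ → ℝ → ℝ) t r q X pt := by
    intro t r q pt
    have h1 : Continuous fun X : Matrix (Fin n) (Fin n) ℝ => (q, X + Z r • outerProd q) := by
      fun_prop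
    have h2 := hH.continuous.comp h1
    exact (h2.add continuous_const).sub continuous_const
  have hstep := fun j : ℕ => cp_step _ hFc (Ω ×ˢ Ioo 0 T) O K0 hK0c hOo hOD hOK u v hsub hsuper
    huK hvK g hgc (x0, t0) hp0K (M - c)
    (by
      intro z hz w hw
      have e1 := hMle z hz
      have e2 := (hc w (hKS hw)).2
      have e3 := hgpos z.2
      linarith)
    α (1 / ((j:ℝ) + 1)) (η / 2 * (1 / ((j:ℝ) + 1))) C hα0 (hj0 j)
    (mul_pos (by positivity) (hj0 j)) (by linarith)
    (by
      have e1 : η / 2 * (1 / ((j:ℝ) + 1)) ≤ η / 2 :=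
        mul_le_of_le_one_right (by positivity) (hj1 j)
      have e2 := le_abs_self (2 * ((M - c) - θ + η / 2))
      have e3 : C ≤ C ^ 2 := by nlinarith
      change 2 * (M - c - θ + η / 2 * (1 / ((j:ℝ) + 1))) ≤ C ^ 2
      linarith)
  choose z hz w hw q q' a b X Y hval hd1 hd2 hq hq' hqq hab hXs hYs hXY hXb hYb hF1 hF2 using hstep
  obtain ⟨zs, hzs, hzlim⟩ := cp_ulim hK0c z hz
  obtain ⟨ws, hws, hwlim⟩ := cp_ulim hK0c w hw
  have hε0 : Filter.Tendsto (fun j : ℕ => 1 / ((j:ℝ) + 1)) (Filter.hyperfilter ℕ : Filter ℕ)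
      (nhds 0) :=
    (tendsto_one_div_add_atTop_nhds_zero_nat (𝕜 := ℝ)).mono_left Nat.hyperfilter_le_atTop
  have hval' : ∀ j, η / 2 ≤ (fun w => u w - g w.2) (z j) - v (w j) := by
    intro j
    have e1 : η / 2 * (1 / ((j:ℝ) + 1)) ≤ η / 2 :=
      mul_le_of_le_one_right (by positivity) (hj1 j)
    have e2 := hval j
    simp only at e2 ⊢
    linarith
  have hlimval := cp_usc_limit (fun w => u w - g w.2) v husc' hvK (η / 2) z w hz hw zs ws hzs hws
    _ hzlim hwlim hval'
  have htz : Filter.Tendsto (fun j => (z j).2) (Filter.hyperfilter ℕ : Filter ℕ) (nhds zs.2) :=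
    (continuous_snd.tendsto zs).comp hzlim
  have htw0 : Filter.Tendsto (fun j => (w j).2) (Filter.hyperfilter ℕ : Filter ℕ) (nhds ws.2) :=
    (continuous_snd.tendsto ws).comp hwlim
  have hteq : zs.2 = ws.2 := by
    have h1 := htz.sub htw0
    have h2 : Filter.Tendsto (fun j => (z j).2 - (w j).2) (Filter.hyperfilter ℕ : Filter ℕ)
        (nhds 0) := by
      refine squeeze_zero_norm (fun j => hd2 j) ?_
      simpa using hε0.mul_const (2 * C)
    linarith [tendsto_nhds_unique h1 h2]
  have htw : Filter.Tendsto (fun j => (w j).2) (Filter.hyperfilter ℕ : Filter ℕ) (nhds zs.2) := by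
    rwa [hteq]
  have hx12 : ‖zs.1 - ws.1‖ ≤ r / 2 := by
    have h1 := (((continuous_fst.tendsto zs).comp hzlim).sub
      ((continuous_fst.tendsto ws).comp hwlim)).norm
    refine le_of_tendsto' h1 fun j => ?_
    rw [← hαC]; exact hd1 j
  have hdist : dist zs ws < r := by
    rw [Prod.dist_eq, hteq, dist_self, dist_eq_norm]
    exact max_lt (by linarith) hr
  obtain ⟨hzO, hwO⟩ := hrO zs hzs ws hws hlimval hdist
  have hzsub := hOD hzO
  have hmem : ∀ p ∈ K0, c ≤ u p ∧ c ≤ v p := fun p hp => hc p (hKS hp)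
  have hvM : ∀ j, v (w j) ≤ u (z j) := by
    intro j
    have e1 := hval' j
    have e2 := hgpos (z j).2
    simp only at e1
    linarith
  refine cp_limit n H k₁ hH T σ hσ χ hχcont fhat hfcont hfpos (deriv g) (hgc.continuous_deriv le_rfl)
    (by intro t; rw [hgd]; exact mul_pos hlam0 (hgpos t))
    (fun j => (z j).2) (fun j => (w j).2) zs.2 hzsub.2 htz htw q q' X Y
    (fun j => Z (u (z j))) (fun j => Z (v (w j))) a b (fun j => η / 2 * (1 / ((j:ℝ) + 1)))
    (C / α) ((1 / α) ^ 2) (Z M) (Z c) (by simpa using hε0.const_mul (η / 2))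
    hq hq' hqq hab hXb hYb hXs hYs hXY ?_ ?_ ?_ ?_ ?_
  · intro j
    have e1 := (hmem _ (hz j)).1
    have e2 := hMle _ (hz j)
    exact ⟨hZanti (mem_Ici.2 (by linarith)) (mem_Ici.2 (by linarith)) e2,
      hZanti (mem_Ici.2 (by linarith)) (mem_Ici.2 (by linarith)) e1⟩
  · intro j
    have e1 := (hmem _ (hw j)).2
    have e2 := (hvM j).trans (hMle _ (hz j))
    exact ⟨hZanti (mem_Ici.2 (by linarith)) (mem_Ici.2 (by linarith)) e2,
      hZanti (mem_Ici.2 (by linarith)) (mem_Ici.2 (by linarith)) e1⟩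
  · intro j
    have e1 := (hmem _ (hw j)).2
    have e2 := (hmem _ (hz j)).1
    exact hZanti (mem_Ici.2 (by linarith)) (mem_Ici.2 (by linarith)) (hvM j)
  · filter_upwards [hzlim.eventually (hOo.mem_nhds hzO)] with j hj
    exact hF1 j hj
  · filter_upwards [hwlim.eventually (hOo.mem_nhds hwO)] with j hj
    exact hF2 j hj
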